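/- arXiv:1208.0296 — 3 statements merged into one kernel-verified Lean document; each statement's English description precedes it below -/
import Mathlib

section
/- Consider a Chinese auction with continuous given budgets, with arbitrary (possibly asymmetric, possibly zero) valuations v_{i,j} ≥ 0 and arbitrary budgets w_i > 0, in which the auctioneer places a ticket of weight Δ_j > 0 in the basket of each item j, so that the utility of player i at profile x is u_i(x) = Σ_{j=1}^m (x_{i,j}/(Δ_j + Σ_{k=1}^n x_{k,j})) v_{i,j}. Then this game has a pure Nash equilibrium. -/
/-- Utility of player `i` in a Chinese auction with given budgets in which the
auctioneer has placed a ticket of weight `Δ j > 0` in the basket of each item `j`. -/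
noncomputable def utilAuc {n m : ℕ} (v : Fin n → Fin m → ℝ) (Δ : Fin m → ℝ)
    (x : Fin n → Fin m → ℝ) (i : Fin n) : ℝ :=
  ∑ j, (x i j / (Δ j + ∑ k, x k j)) * v i j

open MeasureTheory Polynomial in
theorem integral_eval_eq_const_of_Ioo {α : Type*} [MeasurableSpace α] {μ : Measure α}
    {p : α → ℝ[X]} {N : ℕ} (hdeg : ∀ x, (p x).natDegree ≤ N)
    (hintegrable : ∀ t, Integrable (fun x => (p x).eval t) μ) {ε a : ℝ} (hε : 0 < ε)
    (h : ∀ t ∈ Set.Ioo 0 ε, ∫ x, (p x).eval t ∂μ = a) (t : ℝ) :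
    ∫ x, (p x).eval t ∂μ = a := by
  obtain ⟨s, hs, hcard⟩ := (Set.Ioo_infinite hε).exists_subset_card_eq (N + 1)
  have hinj : Set.InjOn (id : ℝ → ℝ) (s : Set ℝ) := Function.injective_id.injOn
  have key (x : α) :
      (p x).eval t = ∑ i ∈ s, (p x).eval i * (Lagrange.basis s id i).eval t := by
    have hlt : (p x).degree < s.card := by
      rw [hcard]
      exact degree_le_natDegree.trans_lt (by exact_mod_cast Nat.lt_succ_of_le (hdeg x))
    conv_lhs => rw [Lagrange.eq_interpolate hinj hlt]
    simp [Lagrange.interpolate_apply, eval_finsetSum]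
  simp_rw [key]
  rw [integral_finsetSum _ fun i _ => (hintegrable i).mul_const _]
  simp_rw [integral_mul_const]
  rw [Finset.sum_congr rfl fun i hi => by rw [h i (hs hi)], ← Finset.mul_sum, ← eval_finsetSum,
    Lagrange.sum_basis hinj (Finset.card_pos.mp (by omega)), eval_one, mul_one]

open Polynomial in
theorem exists_polynomial_eval_eq_det_one_add_smul {E : Type*} [NormedAddCommGroup E]
    [NormedSpace ℝ E] [FiniteDimensional ℝ E] (A : E →L[ℝ] E) :
    ∃ q : ℝ[X], q.natDegree ≤ Module.finrank ℝ E ∧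
      ∀ t : ℝ, q.eval t = (ContinuousLinearMap.id ℝ E + t • A).det := by
  let b := Module.finBasis ℝ E
  let M := LinearMap.toMatrix b b (A : E →ₗ[ℝ] E)
  refine ⟨((X : ℝ[X]) • M.map C + (1 : Matrix _ _ ℝ).map C).det, ?_, fun t => ?_⟩
  · simpa using natDegree_det_X_add_C_le M 1
  · rw [← coe_evalRingHom, RingHom.map_det, ContinuousLinearMap.det, ← LinearMap.det_toMatrix b]
    congr 1
    ext i j
    simp [M, LinearMap.toMatrix_apply, Matrix.one_apply, Finsupp.single_apply, eq_comm (a := i),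
      apply_ite (eval t)]
    ring

theorem exists_pos_forall_det_id_add_pos {E : Type*} [NormedAddCommGroup E]
    [NormedSpace ℝ E] [FiniteDimensional ℝ E] :
    ∃ δ > 0, ∀ A : E →L[ℝ] E, ‖A‖ < δ → 0 < (ContinuousLinearMap.id ℝ E + A).det := by
  have hc : Continuous fun A : E →L[ℝ] E => (ContinuousLinearMap.id ℝ E + A).det :=
    ContinuousLinearMap.continuous_det.comp (continuous_const.add continuous_id)
  have h0 : (0 : ℝ) < (ContinuousLinearMap.id ℝ E + 0).det := by
    rw [add_zero]; simp [ContinuousLinearMap.det]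
  obtain ⟨δ, hδ, h⟩ := Metric.eventually_nhds_iff.mp (hc.continuousAt.eventually_const_lt h0)
  exact ⟨δ, hδ, fun A hA => h (by simpa using hA)⟩


theorem bijective_id_add_smul {E : Type*} [NormedAddCommGroup E] [NormedSpace ℝ E]
    [CompleteSpace E] {g : E → E} {C : NNReal} (hg : LipschitzWith C g) {t : ℝ} (ht : 0 ≤ t)
    (htC : t * C < 1) : Function.Bijective fun x => x + t • g x := by
  constructor
  · intro x y hxy
    have h1 : x - y = t • (g y - g x) := by
      rw [smul_sub, sub_eq_sub_iff_add_eq_add]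
      exact hxy.trans (add_comm _ _)
    have h2 : ‖x - y‖ ≤ t * C * ‖x - y‖ := by
      conv_lhs => rw [h1, norm_smul, Real.norm_of_nonneg ht, norm_sub_rev]
      rw [mul_assoc]
      exact mul_le_mul_of_nonneg_left (hg.norm_sub_le x y) ht
    rw [← sub_eq_zero, ← norm_eq_zero]
    nlinarith [norm_nonneg (x - y)]
  · intro y
    lift t to NNReal using ht
    have hk : ContractingWith (t * C) fun x => y - t • g x := by
      refine ⟨by exact_mod_cast htC, LipschitzWith.of_dist_le_mul fun a b => ?_⟩
      rw [dist_sub_left, NNReal.smul_def, NNReal.smul_def, dist_smul₀, Real.norm_of_nonneg t.coe_nonneg,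
        NNReal.coe_mul, mul_assoc]
      exact mul_le_mul_of_nonneg_left (hg.dist_le_mul a b) t.2
    refine ⟨hk.fixedPoint, ?_⟩
    have := hk.fixedPoint_isFixedPt.eq
    exact (eq_sub_iff_add_eq.mp this.symm)

theorem image_eq_of_bijective_of_eqOn_compl {α : Type*} {f : α → α} (hf : Function.Bijective f)
    {s : Set α} (hs : ∀ x ∉ s, f x = x) : f '' s = s := by
  ext y
  constructor
  · rintro ⟨x, hx, rfl⟩
    by_contra hfx
    exact hfx (by rwa [hf.1 (hs _ hfx)])
  · intro hy
    obtain ⟨x, rfl⟩ := hf.2 y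
    by_contra hx
    exact hx ⟨x, by_contra fun h => h (by rwa [hs x h] at hy), rfl⟩

open MeasureTheory in
theorem exists_pos_forall_integral_comp_id_add_smul {E : Type*} [NormedAddCommGroup E]
    [NormedSpace ℝ E] [FiniteDimensional ℝ E] [MeasurableSpace E] [BorelSpace E] (μ : Measure E)
    [μ.IsAddHaarMeasure] {g : E → E} (hg : ContDiff ℝ 1 g) (hgc : HasCompactSupport g) {s : Set E}
    (hs : MeasurableSet s) (hgs : ∀ x ∉ s, g x = 0) :
    ∃ ε > (0 : ℝ), ∀ t ∈ Set.Ioo 0 ε, ∀ φ : E → ℝ,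
      ∫ x in s, φ (x + t • g x) * (ContinuousLinearMap.id ℝ E + t • fderiv ℝ g x).det ∂μ =
        ∫ x in s, φ x ∂μ := by
  obtain ⟨C, hC⟩ := ContDiff.lipschitzWith_of_hasCompactSupport hgc hg one_ne_zero
  obtain ⟨δ, hδ, hdet⟩ := exists_pos_forall_det_id_add_pos (E := E)
  have hC1 : (0 : ℝ) < C + 1 := by positivity
  refine ⟨min 1 δ / (C + 1), by positivity, fun t ht φ => ?_⟩
  have ht1 : t * (C + 1) < min 1 δ := (lt_div_iff₀ hC1).mp ht.2
  have htC : t * C < min 1 δ := by nlinarith [ht.1]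
  have hbij := bijective_id_add_smul hC ht.1.le (htC.trans_le (min_le_left _ _))
  have himage := image_eq_of_bijective_of_eqOn_compl hbij (s := s) fun x hx => by simp [hgs x hx]
  have hpos (x : E) : 0 < (ContinuousLinearMap.id ℝ E + t • fderiv ℝ g x).det := by
    refine hdet _ ?_
    rw [norm_smul, Real.norm_of_nonneg ht.1.le]
    exact (mul_le_mul_of_nonneg_left (norm_fderiv_le_of_lipschitz ℝ hC) ht.1.le).trans_lt
      (htC.trans_le (min_le_right _ _))
  have hderiv (x : E) : HasFDerivAt (fun x => x + t • g x)
      (ContinuousLinearMap.id ℝ E + t • fderiv ℝ g x) x :=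
    (hasFDerivAt_id x).add ((hg.differentiable one_ne_zero x).hasFDerivAt.const_smul t)
  have := integral_image_eq_integral_abs_det_fderiv_smul μ hs
    (fun x _ => (hderiv x).hasFDerivWithinAt) hbij.1.injOn φ
  rw [himage] at this
  rw [this]
  refine integral_congr_ae (.of_forall fun x => ?_)
  simp only [smul_eq_mul, abs_of_pos (hpos x), mul_comm]

open MeasureTheory Polynomial in
theorem integral_pow_mul_det_id_add_eq {E : Type*} [NormedAddCommGroup E]
    [InnerProductSpace ℝ E] [FiniteDimensional ℝ E] [MeasurableSpace E] [BorelSpace E]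
    (μ : Measure E) [μ.IsAddHaarMeasure] {g : E → E} (hg : ContDiff ℝ 1 g)
    (hgc : HasCompactSupport g) {s : Set E} (hs : IsCompact s) (hgs : ∀ x ∉ s, g x = 0)
    (c : ℝ) (k : ℕ) :
    ∫ x in s, (c - ‖x + g x‖ ^ 2) ^ k * (ContinuousLinearMap.id ℝ E + fderiv ℝ g x).det ∂μ =
      ∫ x in s, (c - ‖x‖ ^ 2) ^ k ∂μ := by
  choose q hqdeg hq using fun x => exists_polynomial_eval_eq_det_one_add_smul (fderiv ℝ g x)
  let p (x : E) : ℝ[X] :=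
    (C (c - ‖x‖ ^ 2) - C (2 * inner ℝ x (g x)) * X - C (‖g x‖ ^ 2) * X ^ 2) ^ k * q x
  have hp (x : E) (t : ℝ) : (p x).eval t = (c - ‖x + t • g x‖ ^ 2) ^ k *
      (ContinuousLinearMap.id ℝ E + t • fderiv ℝ g x).det := by
    simp only [p, eval_mul, eval_pow, eval_sub, eval_C, eval_X, hq, norm_add_sq_real, norm_smul,
      inner_smul_right, Real.norm_eq_abs, mul_pow, sq_abs]
    ring
  have hdeg (x : E) : (p x).natDegree ≤ k * 2 + Module.finrank ℝ E := by
    refine natDegree_mul_le.trans (add_le_add (natDegree_pow_le_of_le k ?_) (hqdeg x))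
    compute_degree
  have hcont (t : ℝ) : Continuous fun x => (p x).eval t := by
    simp_rw [hp]
    have hdg : Continuous (fderiv ℝ g) := hg.continuous_fderiv one_ne_zero
    have hgcont := hg.continuous
    have hdet : Continuous fun x => (ContinuousLinearMap.id ℝ E + t • fderiv ℝ g x).det :=
      ContinuousLinearMap.continuous_det.comp (by fun_prop)
    fun_prop
  obtain ⟨ε, hε, h⟩ :=
    exists_pos_forall_integral_comp_id_add_smul μ hg hgc hs.measurableSet hgs
  have := integral_eval_eq_const_of_Ioo (μ := μ.restrict s) hdeg
    (fun t => ((hcont t).continuousOn.integrableOn_compact hs)) hε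
    (fun t ht => by simpa only [hp] using h t ht fun y => (c - ‖y‖ ^ 2) ^ k) 1
  simpa only [hp, one_smul] using this

open MeasureTheory Metric in
theorem exists_add_eq_zero_of_contDiff_of_hasCompactSupport {E : Type*} [NormedAddCommGroup E]
    [InnerProductSpace ℝ E] [FiniteDimensional ℝ E] {g : E → E} (hg : ContDiff ℝ 1 g)
    (hgc : HasCompactSupport g) : ∃ x, x + g x = 0 := by
  borelize E
  let μ : Measure E := volume
  by_contra! hne
  obtain ⟨R, hR, hgR⟩ := hgc.isCompact.isBounded.subset_closedBall_lt 0 0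
  set s : Set E := closedBall 0 R
  have hs : IsCompact s := isCompact_closedBall 0 R
  have hgs (x : E) (hx : x ∉ s) : g x = 0 :=
    image_eq_zero_of_notMem_tsupport fun h => hx (hgR h)
  have hgcont := hg.continuous
  have hdg : Continuous (fderiv ℝ g) := hg.continuous_fderiv one_ne_zero
  have hcont : Continuous fun x => ‖x + g x‖ := by fun_prop
  have hs0 : s.Nonempty := ⟨0, by simp [s, hR.le]⟩
  obtain ⟨x₀, -, hx₀⟩ := hs.exists_isMinOn hs0 hcont.continuousOn
  obtain ⟨x₁, -, hx₁⟩ := hs.exists_isMaxOn hs0 hcont.continuousOn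
  set d := ‖x₀ + g x₀‖
  have hd : 0 < d := norm_pos_iff.mpr (hne x₀)
  set M := ‖x₁ + g x₁‖
  have hdM (x : E) (hx : x ∈ s) : d ^ 2 ≤ ‖x + g x‖ ^ 2 ∧ ‖x + g x‖ ^ 2 ≤ M ^ 2 :=
    ⟨pow_le_pow_left₀ hd.le (hx₀ hx) 2, pow_le_pow_left₀ (norm_nonneg _) (hx₁ hx) 2⟩
  let c := M ^ 2 + R ^ 2
  let r := min (d / 2) R
  have hr : 0 < r := lt_min (half_pos hd) hR
  have hrR : r ≤ R := min_le_right _ _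
  have hrd : r ≤ d / 2 := min_le_left _ _
  let a := c - d ^ 2
  let b := c - r ^ 2
  have ha : 0 ≤ a := by
    have := hdM 0 (by simp [s, hR.le])
    simp only [a, c]
    nlinarith [sq_nonneg R]
  have hab : a < b := by
    simp only [a, b]
    nlinarith
  have hb : 0 < b := ha.trans_lt hab
  let J : E → ℝ := fun x => (ContinuousLinearMap.id ℝ E + fderiv ℝ g x).det
  have hJ : Continuous J := ContinuousLinearMap.continuous_det.comp (by fun_prop)
  let D := ∫ x in s, |J x| ∂μ
  let V := μ.real (closedBall 0 r)
  have hV : 0 < V :=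
    ENNReal.toReal_pos (measure_closedBall_pos μ 0 hr).ne' measure_closedBall_lt_top.ne
  have hintegrable {φ : E → ℝ} (hφ : Continuous φ) (ρ : ℝ) : IntegrableOn φ (closedBall 0 ρ) μ :=
    hφ.continuousOn.integrableOn_compact (isCompact_closedBall 0 ρ)
  have hle (k : ℕ) : b ^ k * V ≤ a ^ k * D := calc
    b ^ k * V = ∫ x in closedBall 0 r, b ^ k ∂μ := by simp [V, mul_comm]
    _ ≤ ∫ x in closedBall 0 r, (c - ‖x‖ ^ 2) ^ k ∂μ := by
      refine setIntegral_mono_on (hintegrable continuous_const r)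
        (hintegrable (by fun_prop) r) measurableSet_closedBall fun x hx => ?_
      rw [mem_closedBall_zero_iff] at hx
      exact pow_le_pow_left₀ hb.le (sub_le_sub_left (pow_le_pow_left₀ (norm_nonneg x) hx 2) c) k
    _ ≤ ∫ x in s, (c - ‖x‖ ^ 2) ^ k ∂μ := by
      refine setIntegral_mono_set (hintegrable (by fun_prop) R) ?_
        (closedBall_subset_closedBall hrR).eventuallyLE
      refine (ae_restrict_iff' hs.measurableSet).mpr (.of_forall fun x hx => ?_)
      have := pow_le_pow_left₀ (norm_nonneg x) (mem_closedBall_zero_iff.mp hx) 2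
      exact pow_nonneg (by simp only [c]; nlinarith [sq_nonneg M]) k
    _ = ∫ x in s, (c - ‖x + g x‖ ^ 2) ^ k * J x ∂μ :=
      (integral_pow_mul_det_id_add_eq μ hg hgc hs hgs c k).symm
    _ ≤ ∫ x in s, a ^ k * |J x| ∂μ := by
      refine setIntegral_mono_on (hintegrable (by fun_prop) R)
        (hintegrable (by fun_prop) R) hs.measurableSet fun x hx => ?_
      obtain ⟨h1, h2⟩ := hdM x hx
      have h3 : 0 ≤ c - ‖x + g x‖ ^ 2 := by simp only [c]; nlinarith [sq_nonneg R]
      exact (mul_le_mul_of_nonneg_left (le_abs_self _) (pow_nonneg h3 k)).trans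
        (mul_le_mul_of_nonneg_right (pow_le_pow_left₀ h3 (sub_le_sub_left h1 c) k) (abs_nonneg _))
    _ = a ^ k * D := integral_const_mul _ _
  have hlim : Filter.Tendsto (fun k : ℕ => (a / b) ^ k * D) Filter.atTop (nhds (0 * D)) :=
    (tendsto_pow_atTop_nhds_zero_of_lt_one (by positivity) ((div_lt_one hb).mpr hab)).mul_const D
  refine hV.not_ge ((zero_mul D) ▸ ge_of_tendsto' hlim fun k => ?_)
  rw [div_pow, div_mul_eq_mul_div, le_div_iff₀ (by positivity), mul_comm]
  exact hle k

open Metric in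
theorem exists_eq_of_continuous_of_norm_le {E : Type*} [NormedAddCommGroup E]
    [InnerProductSpace ℝ E] [FiniteDimensional ℝ E] {f : E → E} (hf : Continuous f) {R : ℝ}
    (hR : ∀ x, ‖f x‖ ≤ R) : ∃ x, f x = x := by
  have hR0 : 0 ≤ R := (norm_nonneg _).trans (hR 0)
  let χ : E → ℝ := fun x => max 0 (min 1 (R + 2 - ‖x‖))
  have hχ : Continuous χ := by fun_prop
  have hχ1 (x : E) : ‖χ x‖ ≤ 1 := by
    rw [Real.norm_of_nonneg (le_max_left _ _)]
    exact max_le zero_le_one (min_le_left _ _)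
  have hsupp : Function.support (fun x => -(χ x • f x)) ⊆ closedBall 0 (R + 2) := by
    intro x hx
    by_contra hxR
    rw [mem_closedBall_zero_iff, not_le] at hxR
    refine hx ?_
    have : χ x = 0 := max_eq_left ((min_le_right _ _).trans (by linarith))
    simp [this]
  have happrox (ε : ℝ) (hε : 0 < ε) (hε1 : ε ≤ 1) :
      ∃ x ∈ closedBall (0 : E) (R + 1), ‖f x - x‖ < ε := by
    obtain ⟨g, hg, hgf, hgs⟩ := Continuous.exists_contDiff_approx (f := fun x => -(χ x • f x)) 1
      (by fun_prop) (ε := fun _ => ε) continuous_const fun _ => hε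
    obtain ⟨x, hx⟩ := exists_add_eq_zero_of_contDiff_of_hasCompactSupport hg
      (HasCompactSupport.of_support_subset_isCompact (isCompact_closedBall 0 (R + 2))
        (hgs.trans hsupp))
    have hlt : ‖χ x • f x - x‖ < ε := by
      have := hgf x
      rwa [dist_eq_norm, eq_neg_of_add_eq_zero_right hx, sub_neg_eq_add, neg_add_eq_sub] at this
    have hle : ‖χ x • f x‖ ≤ R := by
      rw [norm_smul]
      nlinarith [hχ1 x, hR x, norm_nonneg (f x), norm_nonneg (χ x)]
    have hxR : ‖x‖ ≤ R + 1 := by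
      have := norm_sub_norm_le x (χ x • f x)
      rw [norm_sub_rev] at this
      linarith
    have hχx : χ x = 1 := by
      simp only [χ]
      rw [min_eq_left (by linarith), max_eq_right zero_le_one]
    exact ⟨x, mem_closedBall_zero_iff.mpr hxR, by simpa [hχx] using hlt⟩
  obtain ⟨x, -, hx⟩ := (isCompact_closedBall (0 : E) (R + 1)).exists_isMinOn
    ⟨0, by simp; linarith⟩ (f := fun x => ‖f x - x‖) (by fun_prop)
  refine ⟨x, sub_eq_zero.mp (norm_eq_zero.mp (le_antisymm (not_lt.mp fun h => ?_)
    (norm_nonneg _)))⟩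
  obtain ⟨y, hy, hyx⟩ := happrox (min ‖f x - x‖ 1) (lt_min h one_pos) (min_le_right _ _)
  exact (hx hy).not_gt (hyx.trans_le (min_le_left _ _))

theorem exists_continuous_projection {E : Type*} [NormedAddCommGroup E]
    [InnerProductSpace ℝ E] [CompleteSpace E] {K : Set E} (hne : K.Nonempty)
    (hclosed : IsClosed K) (hconv : Convex ℝ K) :
    ∃ P : E → E, Continuous P ∧
      ∀ x, P x ∈ K ∧ ∀ y ∈ K, inner ℝ (x - P x) (y - P x) ≤ 0 := by
  choose P hPK hP using fun x =>
    exists_norm_eq_iInf_of_complete_convex hne hclosed.isComplete hconv x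
  have hinner (x : E) : ∀ y ∈ K, inner ℝ (x - P x) (y - P x) ≤ 0 :=
    (norm_eq_iInf_iff_real_inner_le_zero hconv (hPK x)).mp (hP x)
  refine ⟨P, LipschitzWith.continuous (K := 1) (LipschitzWith.of_dist_le_mul fun x y => ?_),
    fun x => ⟨hPK x, hinner x⟩⟩
  rw [NNReal.coe_one, one_mul, dist_eq_norm, dist_eq_norm]
  have h1 := hinner x (P y) (hPK y)
  have h2 := hinner y (P x) (hPK x)
  have h3 : ‖P x - P y‖ ^ 2 ≤ inner ℝ (x - y) (P x - P y) := by
    have h4 : inner ℝ (x - y) (P x - P y) - inner ℝ (P x - P y) (P x - P y) =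
        -(inner ℝ (x - P x) (P y - P x) + inner ℝ (y - P y) (P x - P y)) := by
      rw [← neg_sub (P x) (P y), inner_neg_right, neg_add_eq_sub, neg_sub, ← inner_sub_left,
        ← inner_sub_left]
      congr 1
      abel
    rw [← real_inner_self_eq_norm_sq]
    linarith
  have h5 := real_inner_le_norm (x - y) (P x - P y)
  by_contra! hlt
  nlinarith [norm_nonneg (x - y)]

/-- The Hartman–Stampacchia theorem on solvability of variational inequalities. -/
theorem exists_forall_inner_sub_nonpos {E : Type*} [NormedAddCommGroup E]
    [InnerProductSpace ℝ E] [FiniteDimensional ℝ E] {K : Set E} (hne : K.Nonempty)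
    (hK : IsCompact K) (hconv : Convex ℝ K) {F : E → E} (hF : ContinuousOn F K) :
    ∃ x ∈ K, ∀ y ∈ K, inner ℝ (F x) (y - x) ≤ 0 := by
  obtain ⟨P, hPc, hP⟩ := exists_continuous_projection hne hK.isClosed hconv
  obtain ⟨R, hR⟩ := hK.isBounded.exists_norm_le
  have hFP : Continuous fun x => F (P x) := hF.comp_continuous hPc fun x => (hP x).1
  obtain ⟨x, hx⟩ := exists_eq_of_continuous_of_norm_le (f := fun x => P (P x + F (P x)))
    (hPc.comp (hPc.add hFP)) fun x => hR _ (hP _).1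
  refine ⟨P x, (hP x).1, fun y hy => ?_⟩
  have hPx : P x = x := by
    have hxK : x ∈ K := hx ▸ (hP _).1
    have := (hP x).2 x hxK
    rw [real_inner_self_eq_norm_sq] at this
    exact (sub_eq_zero.mp (norm_eq_zero.mp (pow_eq_zero_iff two_ne_zero |>.mp
      (this.antisymm (sq_nonneg _))))).symm
  have := (hP (P x + F (P x))).2 y hy
  simp only [hx] at this
  rw [hPx] at this ⊢
  simpa using this

theorem div_add_sub_div_add_le {a s t : ℝ} (ha : 0 < a) (hs : 0 ≤ s) (ht : 0 ≤ t) :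
    t / (a + t) - s / (a + s) ≤ a / (a + s) ^ 2 * (t - s) := by
  have h : a / (a + s) ^ 2 * (t - s) - (t / (a + t) - s / (a + s)) =
      a * (t - s) ^ 2 / ((a + s) ^ 2 * (a + t)) := by
    field_simp
    ring
  have : 0 ≤ a * (t - s) ^ 2 / ((a + s) ^ 2 * (a + t)) := by positivity
  linarith

/-- With arbitrary nonnegative valuations and arbitrary positive
continuous budgets, if the auctioneer places a strictly positive ticket `Δ j` in each
basket, the resulting game has a pure Nash equilibrium. -/
theorem stmt4 {n m : ℕ} (hm : 0 < m)
    (v : Fin n → Fin m → ℝ) (hv : ∀ i j, 0 ≤ v i j)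
    (w : Fin n → ℝ) (hw : ∀ i, 0 < w i)
    (Δ : Fin m → ℝ) (hΔ : ∀ j, 0 < Δ j) :
    ∃ x : Fin n → Fin m → ℝ,
      (∀ i j, 0 ≤ x i j) ∧ (∀ i, ∑ j, x i j = w i) ∧
      (∀ i : Fin n, ∀ y : Fin m → ℝ, (∀ j, 0 ≤ y j) → (∑ j, y j = w i) →
        utilAuc v Δ (Function.update x i y) i ≤ utilAuc v Δ x i) := by
  let K : Set (EuclideanSpace ℝ (Fin n × Fin m)) :=
    {z | (∀ p, 0 ≤ z p) ∧ ∀ i, ∑ j, z (i, j) = w i}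
  have hKconv : Convex ℝ K := by
    intro y hy z hz a b ha hb hab
    refine ⟨fun p => ?_, fun i => ?_⟩
    · have := hy.1 p
      have := hz.1 p
      simp only [PiLp.add_apply, PiLp.smul_apply, smul_eq_mul]
      positivity
    · simp only [PiLp.add_apply, PiLp.smul_apply, smul_eq_mul, Finset.sum_add_distrib,
        ← Finset.mul_sum, hy.2 i, hz.2 i, ← add_mul, hab, one_mul]
  have hKcl : IsClosed K := by
    have : K = (⋂ p, {z | 0 ≤ z p}) ∩ ⋂ i, {z | ∑ j, z (i, j) = w i} := by
      ext z; simp [K]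
    rw [this]
    exact (isClosed_iInter fun p => isClosed_le (by fun_prop) (by fun_prop)).inter
      (isClosed_iInter fun i => isClosed_eq (by fun_prop) (by fun_prop))
  have hKbdd : Bornology.IsBounded K := by
    refine isBounded_iff_forall_norm_le.mpr ⟨√(∑ p : Fin n × Fin m, w p.1 ^ 2), fun z hz => ?_⟩
    rw [EuclideanSpace.norm_eq]
    refine Real.sqrt_le_sqrt (Finset.sum_le_sum fun p _ => ?_)
    rw [Real.norm_eq_abs, sq_abs]
    refine pow_le_pow_left₀ (hz.1 p) ?_ 2
    rw [← hz.2 p.1]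
    exact Finset.single_le_sum (f := fun j => z (p.1, j)) (fun j _ => hz.1 _) (Finset.mem_univ p.2)
  have hKne : K.Nonempty := by
    refine ⟨WithLp.toLp 2 fun p => w p.1 / m, fun p => ?_, fun i => ?_⟩
    · have := hw p.1
      simp only
      positivity
    · have : (m : ℝ) ≠ 0 := by positivity
      simp
      field_simp
  have hden (z : EuclideanSpace ℝ (Fin n × Fin m)) (hz : z ∈ K) (j : Fin m) :
      0 < Δ j + ∑ k, z (k, j) :=
    add_pos_of_pos_of_nonneg (hΔ j) (Finset.sum_nonneg fun k _ => hz.1 (k, j))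
  let F : EuclideanSpace ℝ (Fin n × Fin m) → EuclideanSpace ℝ (Fin n × Fin m) := fun z =>
    WithLp.toLp 2 fun p =>
      v p.1 p.2 * ((Δ p.2 + ∑ k, z (k, p.2) - z p) / (Δ p.2 + ∑ k, z (k, p.2)) ^ 2)
  have hF : ContinuousOn F K := by
    refine (PiLp.continuous_toLp 2 _).comp_continuousOn (continuousOn_pi.mpr fun p => ?_)
    exact continuousOn_const.mul (ContinuousOn.div (by fun_prop) (by fun_prop)
      fun z hz => (pow_pos (hden z hz p.2) 2).ne')
  obtain ⟨z, hz, hzF⟩ := exists_forall_inner_sub_nonpos hKne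
    (Metric.isCompact_of_isClosed_isBounded hKcl hKbdd) hKconv hF
  refine ⟨fun i j => z (i, j), fun i j => hz.1 _, hz.2, fun i y hy hyw => ?_⟩
  have hvar := hzF (WithLp.toLp 2 fun p => Function.update (fun i j => z (i, j)) i y p.1 p.2) <| by
    constructor
    · rintro ⟨k, j⟩
      rcases eq_or_ne k i with rfl | hk
      · simpa using hy j
      · simpa [hk] using hz.1 (k, j)
    · intro k
      rcases eq_or_ne k i with rfl | hk
      · simpa using hyw
      · simpa [hk] using hz.2 k
  rw [PiLp.inner_apply, Fintype.sum_prod_type, Finset.sum_eq_single i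
    (fun k _ hk => Finset.sum_eq_zero fun j _ => by simp [hk]) (by simp)] at hvar
  simp only [F, PiLp.sub_apply, Function.update_self, RCLike.inner_apply, conj_trivial] at hvar
  rw [← sub_nonpos, utilAuc, utilAuc, ← Finset.sum_sub_distrib]
  refine (Finset.sum_le_sum fun j _ => ?_).trans hvar
  let a := Δ j + ∑ k ∈ Finset.univ.erase i, z (k, j)
  have ha : 0 < a := add_pos_of_pos_of_nonneg (hΔ j) (Finset.sum_nonneg fun k _ => hz.1 (k, j))
  have hsum : Δ j + ∑ k, z (k, j) = a + z (i, j) := by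
    rw [← Finset.sum_erase_add _ _ (Finset.mem_univ i), add_assoc]
  have hsum' : Δ j + ∑ k, Function.update (fun i j => z (i, j)) i y k j = a + y j := by
    rw [← Finset.sum_erase_add _ _ (Finset.mem_univ i), ← add_assoc, Function.update_self]
    congr 2
    exact Finset.sum_congr rfl fun k hk => by
      rw [Function.update_of_ne (Finset.ne_of_mem_erase hk)]
  rw [hsum, hsum', Function.update_self, add_sub_cancel_right, ← sub_mul]
  have := mul_le_mul_of_nonneg_right (div_add_sub_div_add_le ha (hz.1 (i, j)) (hy j)) (hv i j)
  linarith
end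

section
/- Every Chinese auction with continuous given budgets in which all valuations are strictly positive (v_{i,j} > 0 for all players i and items j), with arbitrary (possibly asymmetric) budgets w_i > 0, has a pure Nash equilibrium. -/
/-- Utility of player `i` in a Chinese auction with given budgets and valuations
`v i j`. -/
noncomputable def util {n m : ℕ} (v : Fin n → Fin m → ℝ) (x : Fin n → Fin m → ℝ)
    (i : Fin n) : ℝ :=
  ∑ j, (if 0 < ∑ k, x k j then x i j / (∑ k, x k j) else 0) * v i j

section Degree

open MeasureTheory Metric Set

variable {E : Type*} [NormedAddCommGroup E] [NormedSpace ℝ E] [FiniteDimensional ℝ E]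

/-- The determinant of `1 + t A` is polynomial in `t`, with coefficients continuous in `A`. -/
theorem exists_continuous_coeff_det_one_add_smul :
    ∃ (ι : Type) (_ : Fintype ι) (k : ι → ℕ) (c : ι → (E →L[ℝ] E) → ℝ),
      (∀ s, Continuous (c s)) ∧
      ∀ (t : ℝ) (A : E →L[ℝ] E), (1 + t • A).det = ∑ s, t ^ k s * c s A := by
  classical
  let b := Module.finBasis ℝ E
  let d := Module.finrank ℝ E
  let M : (E →L[ℝ] E) → Matrix (Fin d) (Fin d) ℝ := fun A => LinearMap.toMatrix b b A
  have hM : ∀ i j, Continuous fun A => M A i j := by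
    intro i j
    have h : (fun A => M A i j) = fun A : E →L[ℝ] E => b.coord i (A (b j)) := by
      ext A
      simp [M, LinearMap.toMatrix_apply]
    rw [h]
    exact (LinearMap.continuous_of_finiteDimensional (b.coord i)).comp
      (ContinuousLinearMap.apply ℝ E (b j)).continuous
  refine ⟨Equiv.Perm (Fin d) × Finset (Fin d), inferInstance,
    fun s => (Finset.univ \ s.2).card,
    fun s A => (Equiv.Perm.sign s.1 : ℤ) * ((∏ i ∈ s.2, (1 : Matrix (Fin d) (Fin d) ℝ) (s.1 i) i) *
      ∏ i ∈ Finset.univ \ s.2, M A (s.1 i) i), ?_, ?_⟩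
  · intro s
    exact continuous_const.mul (continuous_const.mul
      (continuous_finsetProd _ fun i _ => hM _ _))
  · intro t A
    have h1 : (1 + t • A).det = (1 + t • M A).det := by
      rw [ContinuousLinearMap.det, ← LinearMap.det_toMatrix b]
      simp [M, ContinuousLinearMap.toLinearMap_add, LinearMap.toMatrix_one]
    rw [h1, Matrix.det_apply', Fintype.sum_prod_type]
    refine Finset.sum_congr rfl fun σ _ => ?_
    simp only [Matrix.add_apply, Matrix.smul_apply, smul_eq_mul]
    rw [Finset.prod_add, Finset.mul_sum, Finset.powerset_univ]
    refine Finset.sum_congr rfl fun S _ => ?_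
    rw [Finset.prod_mul_distrib, Finset.prod_const]
    ring

theorem det_one_add_pos {A : E →L[ℝ] E} (hA : ‖A‖ < 1) : 0 < (1 + A).det := by
  have hne : ∀ t ∈ Icc (0 : ℝ) 1, (1 + t • A).det ≠ 0 := by
    intro t ht h0
    obtain ⟨v, hv, hv0⟩ := (Submodule.ne_bot_iff _).1 (LinearMap.bot_lt_ker_of_det_eq_zero h0).ne'
    have h1 : v + t • A v = 0 := by simpa using hv
    have h2 : ‖v‖ = t * ‖A v‖ := by
      rw [← Real.norm_of_nonneg ht.1, ← norm_smul, ← norm_neg (t • A v),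
        ← eq_neg_of_add_eq_zero_left h1]
    have h3 := A.le_opNorm v
    have h4 : 0 < ‖v‖ := norm_pos_iff.2 hv0
    nlinarith [norm_nonneg (A v), ht.1, ht.2]
  by_contra! hneg
  have hc : ContinuousOn (fun t : ℝ => (1 + t • A).det) (Icc 0 1) :=
    (ContinuousLinearMap.continuous_det.comp (by fun_prop)).continuousOn
  obtain ⟨t, ht, h⟩ := intermediate_value_Icc' zero_le_one hc
    (show (0 : ℝ) ∈ Icc _ _ from ⟨by simpa using hneg, by simp [ContinuousLinearMap.det]⟩)
  exact hne t ht h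

variable [MeasurableSpace E] [BorelSpace E] (μ : Measure E) [μ.IsAddHaarMeasure]

/-- The degree formula for a Lipschitz perturbation of the identity supported in a ball. -/
theorem integral_det_one_add_fderiv {g : E → E} {K : NNReal} {R : ℝ} (hg : LipschitzWith K g)
    (h0 : ∀ x, R ≤ ‖x‖ → g x = 0) (hd : ∀ x ∈ ball (0 : E) R, DifferentiableAt ℝ g x) :
    ∫ x in ball 0 R, (1 + fderiv ℝ g x).det ∂μ = μ.real (ball 0 R) := by
  have hsmall : ∀ t : ℝ, 0 ≤ t → t * K < 1 →
      ∫ x in ball 0 R, (1 + t • fderiv ℝ g x).det ∂μ = μ.real (ball 0 R) := by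
    intro t ht htK
    let f : E → E := fun x => x + t • g x
    have hfL : ApproximatesLinearOn f (ContinuousLinearEquiv.refl ℝ E : E →L[ℝ] E) univ
        (t.toNNReal * K) := by
      intro x _ y _
      have h := hg.dist_le_mul x y
      rw [dist_eq_norm, dist_eq_norm] at h
      have e : f x - f y - (ContinuousLinearEquiv.refl ℝ E : E →L[ℝ] E) (x - y) =
          t • (g x - g y) := by
        simp only [f, ContinuousLinearEquiv.coe_refl, ContinuousLinearMap.coe_id', id, smul_sub]
        abel
      rw [e, norm_smul, Real.norm_of_nonneg ht]
      rw [NNReal.coe_mul, Real.coe_toNNReal t ht, mul_assoc]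
      exact mul_le_mul_of_nonneg_left h ht
    have hc : Subsingleton E ∨ (t.toNNReal * K : NNReal) <
        ‖((ContinuousLinearEquiv.refl ℝ E).symm : E →L[ℝ] E)‖₊⁻¹ := by
      rcases subsingleton_or_nontrivial E with h | h
      · exact Or.inl h
      · right
        rw [← NNReal.coe_lt_coe, NNReal.coe_mul, Real.coe_toNNReal t ht]
        simpa using htK
    have hinj : Function.Injective f := injOn_univ.1 (hfL.injOn hc)
    have hsurj : Function.Surjective f := hfL.surjective hc
    have hout : ∀ x, x ∉ ball (0 : E) R → f x = x := by
      intro x hx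
      simp [f, h0 x (by simpa using hx)]
    have himg : f '' ball 0 R = ball 0 R := by
      ext y
      constructor
      · rintro ⟨x, hx, rfl⟩
        by_contra h
        exact h ((hinj (hout _ h)).symm ▸ hx)
      · intro hy
        obtain ⟨x, rfl⟩ := hsurj y
        by_contra h
        have hx : x ∉ ball (0 : E) R := fun hx => h ⟨x, hx, rfl⟩
        exact hx (hout x hx ▸ hy)
    have hder : ∀ x ∈ ball (0 : E) R,
        HasFDerivWithinAt f (1 + t • fderiv ℝ g x) (ball 0 R) x := fun x hx =>
      ((hasFDerivAt_id x).add ((hd x hx).hasFDerivAt.const_smul t)).hasFDerivWithinAt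
    have hcv := integral_image_eq_integral_abs_det_fderiv_smul μ measurableSet_ball hder
      hinj.injOn (fun _ => (1 : ℝ))
    rw [himg] at hcv
    simp only [smul_eq_mul, mul_one, integral_const, measureReal_restrict_apply_univ] at hcv
    rw [hcv]
    refine setIntegral_congr_fun measurableSet_ball fun x _ => (abs_of_pos ?_).symm
    refine det_one_add_pos (lt_of_le_of_lt ?_ htK)
    rw [norm_smul, Real.norm_of_nonneg ht]
    exact mul_le_mul_of_nonneg_left (norm_fderiv_le_of_lipschitz ℝ hg) ht
  obtain ⟨ι, _, k, c, hc, hdet⟩ := exists_continuous_coeff_det_one_add_smul (E := E)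
  have hint : ∀ s, IntegrableOn (fun x => c s (fderiv ℝ g x)) (ball 0 R) μ := by
    intro s
    have : ProperSpace (E →L[ℝ] E) := FiniteDimensional.proper ℝ _
    obtain ⟨C, hC⟩ := (isCompact_closedBall (0 : E →L[ℝ] E) K).exists_bound_of_continuousOn
      (hc s).continuousOn
    refine Measure.integrableOn_of_bounded measure_ball_lt_top.ne
      (((hc s).measurable.comp (measurable_fderiv ℝ g)).aestronglyMeasurable) (M := C) ?_
    exact Filter.Eventually.of_forall fun x =>
      hC _ (by simpa using norm_fderiv_le_of_lipschitz ℝ hg)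
  let P : Polynomial ℝ := ∑ s, Polynomial.C (∫ x in ball 0 R, c s (fderiv ℝ g x) ∂μ) *
    Polynomial.X ^ k s
  have hP : ∀ t, ∫ x in ball 0 R, (1 + t • fderiv ℝ g x).det ∂μ = P.eval t := by
    intro t
    simp only [hdet, P, Polynomial.eval_finsetSum, Polynomial.eval_mul, Polynomial.eval_C,
      Polynomial.eval_pow, Polynomial.eval_X]
    rw [integral_finsetSum _ fun s _ => (hint s).const_mul _]
    exact Finset.sum_congr rfl fun s _ => by rw [integral_const_mul, mul_comm]
  have hPC : P = Polynomial.C (μ.real (ball 0 R)) := by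
    refine Polynomial.eq_of_infinite_eval_eq _ _ ?_
    refine (Ioo_infinite (show (0 : ℝ) < 1 / (K + 1) by positivity)).mono fun t ht => ?_
    have hK : (0 : ℝ) < K + 1 := by positivity
    have := (lt_div_iff₀ hK).1 ht.2
    rw [mem_ofPred_eq, ← hP, hsmall t ht.1.le (by nlinarith [ht.1]), Polynomial.eval_C]
  have := hP 1
  rw [hPC, Polynomial.eval_C] at this
  simpa using this

end Degree

section Brouwer

open MeasureTheory Metric Set

variable {E : Type*} [NormedAddCommGroup E]

theorem norm_inv_norm_smul_sub_le [NormedSpace ℝ E] {a b : E} (ha : a ≠ 0) (hb : b ≠ 0) :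
    ‖‖a‖⁻¹ • a - ‖b‖⁻¹ • b‖ ≤ 2 * ‖a - b‖ / ‖a‖ := by
  have ha' : 0 < ‖a‖ := norm_pos_iff.2 ha
  have hb' : 0 < ‖b‖ := norm_pos_iff.2 hb
  have e : ‖a‖⁻¹ • a - ‖b‖⁻¹ • b = ‖a‖⁻¹ • (a - b) + ((‖b‖ - ‖a‖) / (‖a‖ * ‖b‖)) • b := by
    rw [show (‖b‖ - ‖a‖) / (‖a‖ * ‖b‖) = ‖a‖⁻¹ - ‖b‖⁻¹ by field_simp, smul_sub, sub_smul]
    abel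
  have h1 : |‖b‖ - ‖a‖| ≤ ‖a - b‖ := by
    rw [abs_sub_comm]
    exact abs_norm_sub_norm_le a b
  rw [e]
  refine (norm_add_le _ _).trans ?_
  rw [norm_smul, norm_smul, norm_inv, norm_norm, Real.norm_eq_abs, abs_div, abs_mul, abs_norm,
    abs_norm]
  have h2 : |‖b‖ - ‖a‖| / (‖a‖ * ‖b‖) * ‖b‖ = |‖b‖ - ‖a‖| / ‖a‖ := by field_simp
  rw [h2, ← div_eq_inv_mul, ← add_div]
  gcongr
  linarith

variable [InnerProductSpace ℝ E] [FiniteDimensional ℝ E]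

theorem det_fderiv_eq_zero_of_norm_eq_const {r : E → E} {r' : E →L[ℝ] E} {x : E} {c : ℝ}
    (hc : 0 < c) (hr : HasFDerivAt r r' x) (h : ∀ᶠ y in nhds x, ‖r y‖ = c) : r'.det = 0 := by
  by_contra hdet
  obtain ⟨v, hv⟩ := (LinearMap.equivOfDetNeZero _ hdet).surjective (r x)
  have hv' : r' v = r x := hv
  have h1 : HasFDerivAt (fun _ : E => c ^ 2) (2 • (innerSL ℝ (r x)).comp r') x :=
    hr.norm_sq.congr_of_eventuallyEq (h.mono fun y hy => by simp [hy])
  have h2 := congrArg (fun L : E →L[ℝ] ℝ => L v) (h1.unique (hasFDerivAt_const _ x))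
  simp [hv', norm_eq_zero] at h2
  have h3 := h.self_of_nhds
  rw [h2, norm_zero] at h3
  exact hc.ne h3

/-- A map of a Euclidean space which is a smooth compactly supported perturbation of the identity
has a zero. -/
theorem exists_eq_self_of_contDiff {g : E → E} (hg : ContDiff ℝ 1 g)
    (hs : ∀ x, 2 ≤ ‖x‖ → g x = 0) (hb : ∀ x, ‖g x‖ ≤ 2) : ∃ x, g x = x := by
  by_contra! hne
  borelize E
  let F : E → E := fun x => x - g x
  have hF : ∀ x, F x ≠ 0 := fun x h => hne x (sub_eq_zero.1 h).symm
  have hFd : Differentiable ℝ F := differentiable_id.sub (hg.differentiable one_ne_zero)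
  have hF2 : ∀ x, 2 ≤ ‖x‖ → F x = x := fun x hx => by simp [F, hs x hx]
  have hF4 : ∀ x, ‖x‖ < 4 → ‖F x‖ < 4 := by
    intro x hx
    rcases le_or_gt 2 ‖x‖ with h | h
    · rwa [hF2 x h]
    · linarith [norm_sub_le x (g x), hb x]
  obtain ⟨K, hK⟩ := hg.lipschitzWith_of_hasCompactSupport
    (HasCompactSupport.intro (isCompact_closedBall (0 : E) 2) fun x hx =>
      hs x (by simpa using (not_le.1 (by simpa using hx)).le)) one_ne_zero
  have hgL : ∀ x y, ‖g x - g y‖ ≤ K * ‖x - y‖ := fun x y => by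
    simpa [dist_eq_norm] using hK.dist_le_mul x y
  have hFL : ∀ x y, ‖F x - F y‖ ≤ (1 + K) * ‖x - y‖ := fun x y => by
    have e : F x - F y = (x - y) - (g x - g y) := by simp only [F]; abel
    rw [e]
    linarith [norm_sub_le (x - y) (g x - g y), hgL x y]
  obtain ⟨δ, hδ, hFδ⟩ : ∃ δ > 0, ∀ x, δ ≤ ‖F x‖ := by
    obtain ⟨x₀, -, hx₀⟩ := (isCompact_closedBall (0 : E) 4).exists_isMinOn
      ⟨0, by simp⟩ hFd.continuous.norm.continuousOn
    refine ⟨min ‖F x₀‖ 4, lt_min (norm_pos_iff.2 (hF x₀)) (by norm_num), fun x => ?_⟩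
    rcases le_or_gt ‖x‖ 4 with h | h
    · exact (min_le_left _ _).trans (hx₀ (by simpa using h))
    · rw [hF2 x (by linarith)]
      exact (min_le_right _ _).trans h.le
  let c : E → ℝ := fun x => max 0 (4 - ‖F x‖)
  let G : E → E := fun x => c x • (‖F x‖⁻¹ • F x) - g x
  have hGL : LipschitzWith (Real.toNNReal ((1 + K) + 4 * (2 * (1 + K) / δ) + K)) G := by
    refine LipschitzWith.of_dist_le' fun x y => ?_
    rw [dist_eq_norm, dist_eq_norm]
    have hcL : |c x - c y| ≤ (1 + K) * ‖x - y‖ := by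
      refine (abs_max_sub_max_le_max _ _ _ _).trans ?_
      rw [sub_self, abs_zero, max_eq_right (abs_nonneg _),
        show 4 - ‖F x‖ - (4 - ‖F y‖) = -(‖F x‖ - ‖F y‖) by ring, abs_neg]
      exact (abs_norm_sub_norm_le _ _).trans (hFL x y)
    have hcy : |c y| ≤ 4 := by
      rw [abs_of_nonneg (le_max_left _ _)]
      exact max_le (by norm_num) (by linarith [norm_nonneg (F y)])
    have hN : ‖‖F x‖⁻¹ • F x - ‖F y‖⁻¹ • F y‖ ≤ 2 * (1 + K) / δ * ‖x - y‖ := by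
      refine (norm_inv_norm_smul_sub_le (hF x) (hF y)).trans ?_
      rw [div_mul_eq_mul_div, mul_assoc]
      have := hFL x y
      have := hFδ x
      gcongr
    have hN1 : ‖‖F x‖⁻¹ • F x‖ = 1 := by
      rw [norm_smul, norm_inv, norm_norm, inv_mul_cancel₀ (norm_ne_zero_iff.2 (hF x))]
    have e : G x - G y = (c x - c y) • (‖F x‖⁻¹ • F x) +
        c y • (‖F x‖⁻¹ • F x - ‖F y‖⁻¹ • F y) - (g x - g y) := by
      simp only [G, smul_sub, sub_smul]
      abel
    calc ‖G x - G y‖ ≤ |c x - c y| * 1 + |c y| * ‖‖F x‖⁻¹ • F x - ‖F y‖⁻¹ • F y‖ + ‖g x - g y‖ := by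
          rw [e, ← hN1, ← Real.norm_eq_abs, ← Real.norm_eq_abs, ← norm_smul, ← norm_smul]
          exact (norm_sub_le _ _).trans (add_le_add_left (norm_add_le _ _) _)
      _ ≤ (1 + K) * ‖x - y‖ * 1 + 4 * (2 * (1 + K) / δ * ‖x - y‖) + K * ‖x - y‖ := by
          have := hgL x y
          gcongr
      _ = _ := by ring
  have hG0 : ∀ x, 4 ≤ ‖x‖ → G x = 0 := by
    intro x hx
    have : c x = 0 := max_eq_left (by rw [hF2 x (by linarith)]; linarith)
    simp [G, this, hs x (by linarith)]
  have hGr : ∀ x ∈ ball (0 : E) 4, x + G x = (4 * ‖F x‖⁻¹) • F x := by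
    intro x hx
    have h4 : c x = 4 - ‖F x‖ := max_eq_right (by linarith [hF4 x (by simpa using hx)])
    have h5 : ‖F x‖ * ‖F x‖⁻¹ = 1 := mul_inv_cancel₀ (norm_ne_zero_iff.2 (hF x))
    simp only [G, h4, smul_smul, sub_mul, sub_smul, h5, one_smul]
    simp only [F]
    abel
  have hGd : ∀ x ∈ ball (0 : E) 4, DifferentiableAt ℝ G x := by
    intro x hx
    have h1 : DifferentiableAt ℝ (fun y => (4 * ‖F y‖⁻¹) • F y - y) x :=
      (((((hFd x).norm ℝ (hF x)).inv (norm_ne_zero_iff.2 (hF x))).const_mul 4).smul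
        (hFd x)).sub differentiableAt_id
    refine h1.congr_of_eventuallyEq ?_
    filter_upwards [isOpen_ball.mem_nhds hx] with y hy
    rw [← hGr y hy, add_sub_cancel_left]
  have hdeg := integral_det_one_add_fderiv (volume : Measure E) hGL hG0 hGd
  rw [setIntegral_congr_fun measurableSet_ball (g := fun _ => (0 : ℝ)) fun x hx => ?_] at hdeg
  · simp only [integral_zero] at hdeg
    exact (ENNReal.toReal_pos (measure_ball_pos volume (0 : E) (by norm_num : (0 : ℝ) < 4)).ne'
      measure_ball_lt_top.ne).ne hdeg
  · refine det_fderiv_eq_zero_of_norm_eq_const (r := fun y => y + G y) (by norm_num : (0 : ℝ) < 4)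
      ((hasFDerivAt_id x).add (hGd x hx).hasFDerivAt) ?_
    filter_upwards [isOpen_ball.mem_nhds hx] with y hy
    rw [hGr y hy, norm_smul, norm_mul, norm_inv, norm_norm, Real.norm_of_nonneg (by norm_num),
      mul_assoc, inv_mul_cancel₀ (norm_ne_zero_iff.2 (hF y)), mul_one]

/-- **Brouwer's fixed point theorem** for continuous maps into the unit ball. -/
theorem exists_eq_self_of_norm_le_one {h : E → E} (hc : Continuous h) (hb : ∀ x, ‖h x‖ ≤ 1) :
    ∃ x, h x = x := by
  by_contra! hne
  let χ : E → ℝ := fun x => max 0 (min 1 (2 - ‖x‖))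
  let p : E → E := fun x => χ x • h x
  have hχ : Continuous χ := by fun_prop
  have hp : Continuous p := hχ.smul hc
  have hχ0 : ∀ x, 0 ≤ χ x := fun x => le_max_left _ _
  have hχ1 : ∀ x, χ x ≤ 1 := fun x => max_le zero_le_one (min_le_left _ _)
  have hp1 : ∀ x, ‖p x‖ ≤ 1 := fun x => by
    rw [norm_smul, Real.norm_of_nonneg (hχ0 x)]
    exact mul_le_one₀ (hχ1 x) (norm_nonneg _) (hb x)
  have hpne : ∀ x, x - p x ≠ 0 := by
    intro x hx
    rw [sub_eq_zero] at hx
    have h1 : χ x = 1 := by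
      have := hp1 x
      rw [← hx] at this
      simp only [χ]
      rw [min_eq_left (by linarith), max_eq_right zero_le_one]
    refine hne x ?_
    conv_rhs => rw [hx]
    simp [p, h1]
  obtain ⟨g, hg, hgp, hgs⟩ := hp.exists_contDiff_approx 1 (ε := fun x => min ‖x - p x‖ 1)
    (by fun_prop) fun x => lt_min (norm_pos_iff.2 (hpne x)) one_pos
  obtain ⟨x, hx⟩ := exists_eq_self_of_contDiff hg
    (fun x hx => by
      by_contra h
      refine hgs h ?_
      have : χ x = 0 := max_eq_left ((min_le_right _ _).trans (by linarith))
      simp [p, this])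
    (fun x => by
      have h1 := (hgp x).trans_le (min_le_right _ _)
      rw [dist_eq_norm] at h1
      have h2 := norm_add_le (g x - p x) (p x)
      rw [sub_add_cancel] at h2
      linarith [hp1 x])
  have h1 := (hgp x).trans_le (min_le_left _ _)
  rw [hx, dist_eq_norm] at h1
  exact lt_irrefl _ h1

end Brouwer

section VariationalInequality

open Metric Set
open scoped InnerProductSpace

theorem exists_projection_of_isCompact_convex {E : Type*} [NormedAddCommGroup E]
    [InnerProductSpace ℝ E] {K : Set E} (hne : K.Nonempty) (hK : IsCompact K)
    (hconv : Convex ℝ K) :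
    ∃ π : E → E, Continuous π ∧ (∀ u, π u ∈ K) ∧ ∀ u, ∀ w ∈ K, ⟪u - π u, w - π u⟫_ℝ ≤ 0 := by
  choose π hπK hπ using exists_norm_eq_iInf_of_complete_convex hne hK.isComplete hconv
  have hπ' : ∀ u, ∀ w ∈ K, ⟪u - π u, w - π u⟫_ℝ ≤ 0 := fun u =>
    (norm_eq_iInf_iff_real_inner_le_zero hconv (hπK u)).1 (hπ u)
  refine ⟨π, (LipschitzWith.of_dist_le_mul (K := 1) fun u v => ?_).continuous, hπK, hπ'⟩
  rw [NNReal.coe_one, one_mul, dist_eq_norm, dist_eq_norm]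
  have h1 := hπ' u (π v) (hπK v)
  have h2 := hπ' v (π u) (hπK u)
  have h3 : ‖π u - π v‖ * ‖π u - π v‖ ≤ ⟪u - v, π u - π v⟫_ℝ := by
    rw [← real_inner_self_eq_norm_mul_norm]
    simp only [inner_sub_left, inner_sub_right] at h1 h2 ⊢
    linarith
  have h4 := h3.trans (real_inner_le_norm _ _)
  rcases (norm_nonneg (π u - π v)).eq_or_lt with h | h
  · exact h ▸ norm_nonneg _
  · exact le_of_mul_le_mul_right h4 h

/-- **Hartman–Stampacchia theorem**: a continuous map on a compact convex set admits a solution of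
the associated variational inequality. -/
theorem exists_forall_inner_nonneg {E : Type*} [NormedAddCommGroup E] [InnerProductSpace ℝ E]
    [FiniteDimensional ℝ E] {K : Set E} (hne : K.Nonempty) (hK : IsCompact K)
    (hconv : Convex ℝ K) {Φ : E → E} (hΦ : ContinuousOn Φ K) :
    ∃ x ∈ K, ∀ y ∈ K, 0 ≤ ⟪Φ x, y - x⟫_ℝ := by
  obtain ⟨π, hπc, hπK, hπ⟩ := exists_projection_of_isCompact_convex hne hK hconv
  have hfix : ∀ x ∈ K, π x = x := by
    intro x hx
    have h := hπ x x hx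
    rw [real_inner_self_nonpos, sub_eq_zero] at h
    exact h.symm
  obtain ⟨R, hR, hKR⟩ := hK.isBounded.exists_pos_norm_le
  let q : E → E := fun z => π (R • z)
  have hq : Continuous q := hπc.comp (by fun_prop)
  obtain ⟨z, hz⟩ := exists_eq_self_of_norm_le_one (h := fun z => R⁻¹ • π (q z - Φ (q z)))
    ((hπc.comp (hq.sub (hΦ.comp_continuous hq fun _ => hπK _))).const_smul _) fun z => by
      rw [norm_smul, norm_inv, Real.norm_of_nonneg hR.le, inv_mul_le_one₀ hR]
      exact hKR _ (hπK _)
  have hx : π (q z - Φ (q z)) = R • z := by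
    rw [← hz, smul_inv_smul₀ hR.ne', hz]
  have hzK : R • z ∈ K := hx ▸ hπK _
  have hqz : q z = R • z := hfix _ hzK
  refine ⟨R • z, hzK, fun y hy => ?_⟩
  have h := hπ (q z - Φ (q z)) y hy
  rw [hx, hqz, sub_sub_cancel_left, inner_neg_left] at h
  linarith

theorem exists_forall_sum_mul_sub_nonneg {ι : Type*} [Fintype ι] {K : Set (ι → ℝ)}
    (hne : K.Nonempty) (hK : IsCompact K) (hconv : Convex ℝ K) {Φ : (ι → ℝ) → ι → ℝ}
    (hΦ : ContinuousOn Φ K) : ∃ x ∈ K, ∀ y ∈ K, 0 ≤ ∑ i, Φ x i * (y i - x i) := by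
  let e := EuclideanSpace.equiv ι ℝ
  obtain ⟨x, hx, h⟩ := exists_forall_inner_nonneg (K := e ⁻¹' K)
    (Φ := fun x => e.symm (Φ (e x))) (hne.preimage e.surjective)
    (e.toHomeomorph.isCompact_preimage.2 hK) (hconv.linear_preimage e.toLinearMap)
    (e.symm.continuous.comp_continuousOn (hΦ.comp e.continuous.continuousOn fun _ h => h))
  refine ⟨e x, hx, fun y hy => ?_⟩
  have := h (e.symm y) (by simpa using hy)
  simpa [PiLp.inner_apply, e, mul_comm] using this

end VariationalInequality

section Auction

open Set

theorem exists_forall_sum_marginal_nonpos {n m : ℕ} (hm : 0 < m) (w : Fin n → ℝ)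
    (hw : ∀ i, 0 < w i) {D : (Fin n → Fin m → ℝ) → Fin n → Fin m → ℝ} (hD : Continuous D) :
    ∃ x : Fin n → Fin m → ℝ, (∀ i j, 0 ≤ x i j) ∧ (∀ i, ∑ j, x i j = w i) ∧
      ∀ i, ∀ y : Fin m → ℝ, (∀ j, 0 ≤ y j) → ∑ j, y j = w i →
        ∑ j, D x i j * (y j - x i j) ≤ 0 := by
  classical
  let K : Set (Fin n × Fin m → ℝ) :=
    {f | (∀ p, 0 ≤ f p) ∧ ∀ i, ∑ j, f (i, j) = w i}
  have hne : K.Nonempty := by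
    have hm' : (m : ℝ) ≠ 0 := by positivity
    refine ⟨fun p => w p.1 / m, fun p => div_nonneg (hw _).le (Nat.cast_nonneg _), fun i => ?_⟩
    simp only [Finset.sum_const, Finset.card_univ, Fintype.card_fin, nsmul_eq_mul]
    field_simp
  have hcl : IsClosed K := by
    refine IsClosed.inter (s₁ := {f : Fin n × Fin m → ℝ | ∀ p, 0 ≤ f p})
      (s₂ := {f : Fin n × Fin m → ℝ | ∀ i, ∑ j, f (i, j) = w i}) ?_ ?_
    · rw [ofPred_forall]
      exact isClosed_iInter fun p => isClosed_le continuous_const (continuous_apply p)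
    · rw [ofPred_forall]
      exact isClosed_iInter fun i => isClosed_eq (by fun_prop) continuous_const
  have hK : IsCompact K := by
    refine (isCompact_Icc (a := (0 : Fin n × Fin m → ℝ)) (b := fun p => w p.1)).of_isClosed_subset
      hcl fun f hf => ⟨hf.1, fun p => ?_⟩
    dsimp only
    rw [← hf.2 p.1]
    exact Finset.single_le_sum (f := fun j => f (p.1, j)) (fun j _ => hf.1 _) (Finset.mem_univ p.2)
  have hconv : Convex ℝ K := by
    intro f hf g hg a b ha hb hab
    refine ⟨fun p => add_nonneg (mul_nonneg ha (hf.1 p)) (mul_nonneg hb (hg.1 p)), fun i => ?_⟩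
    simp only [Pi.add_apply, Pi.smul_apply, smul_eq_mul, Finset.sum_add_distrib, ← Finset.mul_sum,
      hf.2, hg.2]
    rw [← add_mul, hab, one_mul]
  obtain ⟨f, hf, h⟩ := exists_forall_sum_mul_sub_nonneg hne hK hconv
    (Φ := fun f p => -D (fun i j => f (i, j)) p.1 p.2) (Continuous.continuousOn (by fun_prop))
  refine ⟨fun i j => f (i, j), fun i j => hf.1 _, hf.2, fun i y hy hyw => ?_⟩
  have h1 := h (fun p => if p.1 = i then y p.2 else f p) ⟨fun p => ?_, fun k => ?_⟩
  · rw [Fintype.sum_prod_type, Finset.sum_eq_single i] at h1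
    · simpa using h1
    · intro k _ hk
      simp [hk]
    · simp
  · dsimp only
    split_ifs
    exacts [hy _, hf.1 p]
  · by_cases hk : k = i
    · simp [hk, hyw]
    · simp [hk, hf.2]

theorem div_add_sub_div_add_le_s5 {b x y : ℝ} (hb : 0 ≤ b) (hx : 0 < x + b) (hy : 0 < y + b) :
    y / (y + b) - x / (x + b) ≤ b / (x + b) ^ 2 * (y - x) := by
  have e : b / (x + b) ^ 2 * (y - x) - (y / (y + b) - x / (x + b)) =
      b * (y - x) ^ 2 / ((y + b) * (x + b) ^ 2) := by
    field_simp
    ring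
  have : 0 ≤ b * (y - x) ^ 2 / ((y + b) * (x + b) ^ 2) := by positivity
  linarith

/-- First-order conditions suffice for a best response when every item receives a positive bid. -/
theorem util_update_le_of_sum_marginal_nonpos {n m : ℕ} {v x : Fin n → Fin m → ℝ} {i : Fin n}
    {y : Fin m → ℝ} (hv : ∀ j, 0 ≤ v i j) (hx : ∀ i j, 0 ≤ x i j) (hT : ∀ j, 0 < ∑ k, x k j)
    (hy : ∀ j, 0 ≤ y j)
    (h : ∑ j, v i j * (∑ k, x k j - x i j) / (∑ k, x k j) ^ 2 * (y j - x i j) ≤ 0) :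
    util v (Function.update x i y) i ≤ util v x i := by
  rw [← sub_nonpos]
  refine le_trans ?_ h
  rw [util, util, ← Finset.sum_sub_distrib]
  refine Finset.sum_le_sum fun j _ => ?_
  have hsum : ∑ k, Function.update x i y k j = y j + (∑ k, x k j - x i j) := by
    rw [← Finset.add_sum_erase _ _ (Finset.mem_univ i),
      ← Finset.add_sum_erase _ (fun k => x k j) (Finset.mem_univ i), Function.update_self,
      add_sub_cancel_left]
    congr 1
    exact Finset.sum_congr rfl fun k hk => by
      rw [Function.update_of_ne (Finset.ne_of_mem_erase hk)]
  have hb : 0 ≤ ∑ k, x k j - x i j :=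
    sub_nonneg.2 (Finset.single_le_sum (f := fun k => x k j) (fun k _ => hx k j)
      (Finset.mem_univ i))
  rw [hsum, Function.update_self, if_pos (hT j), ← sub_mul]
  generalize hbdef : ∑ k, x k j - x i j = b at *
  have hTb : ∑ k, x k j = x i j + b := by linarith
  have hpos := hT j
  rw [hTb] at hpos ⊢
  rw [mul_comm, mul_div_assoc, mul_assoc]
  refine mul_le_mul_of_nonneg_left ?_ (hv j)
  split_ifs with hyb
  · exact div_add_sub_div_add_le_s5 hb hpos hyb
  · have hb0 : b = 0 := by linarith [hy j]
    have : 0 ≤ x i j / (x i j + b) := div_nonneg (hx i j) hpos.le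
    simp only [hb0] at this ⊢
    simpa using this

theorem exists_nash_of_two_le {n m : ℕ} (hn : 2 ≤ n) (hm : 0 < m)
    (v : Fin n → Fin m → ℝ) (hv : ∀ i j, 0 < v i j) (w : Fin n → ℝ) (hw : ∀ i, 0 < w i) :
    ∃ x : Fin n → Fin m → ℝ,
      (∀ i j, 0 ≤ x i j) ∧ (∀ i, ∑ j, x i j = w i) ∧
      (∀ i : Fin n, ∀ y : Fin m → ℝ, (∀ j, 0 ≤ y j) → (∑ j, y j = w i) →
        util v (Function.update x i y) i ≤ util v x i) := by
  have hm0 : (0 : ℝ) < m := Nat.cast_pos.2 hm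
  obtain ⟨ε, hε, hε0⟩ : ∃ ε : ℝ, (∀ i j k, ε * m < w i ∧ 2 * ε * m * v i k < v i j * w i) ∧
      0 < ε := by
    have h1 : ∀ᶠ ε : ℝ in nhdsWithin 0 (Ioi 0),
        ∀ i j k, ε * m < w i ∧ 2 * ε * m * v i k < v i j * w i := by
      simp only [Filter.eventually_all]
      intro i j k
      refine Filter.Eventually.filter_mono nhdsWithin_le_nhds ?_
      refine Filter.Eventually.and ?_ ?_
      · exact (continuous_id.mul continuous_const).tendsto' 0 0 (by simp) |>.eventually_lt_const
          (hw i)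
      · exact Filter.Tendsto.eventually_lt_const (mul_pos (hv i j) (hw i))
          (Continuous.tendsto' (by fun_prop) 0 0 (by simp))
    exact (h1.and self_mem_nhdsWithin).exists
  let τ : (Fin n → Fin m → ℝ) → Fin m → ℝ := fun x j => max (∑ k, x k j) ε
  have hτ : ∀ x j, 0 < τ x j := fun x j => lt_max_of_lt_right hε0
  obtain ⟨x, hx, hxw, hopt⟩ := exists_forall_sum_marginal_nonpos hm w hw
    (D := fun x i j => v i j * (τ x j - x i j) / τ x j ^ 2) (by
      refine continuous_pi fun i => continuous_pi fun j => ?_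
      exact Continuous.div (by fun_prop) (by fun_prop) fun x => (pow_pos (hτ x j) 2).ne')
  have hxT : ∀ i j, x i j ≤ ∑ k, x k j := fun i j =>
    Finset.single_le_sum (f := fun k => x k j) (fun k _ => hx k j) (Finset.mem_univ i)
  have hT : ∀ j, ε ≤ ∑ k, x k j := by
    intro j
    by_contra! hlt
    obtain ⟨i, hi⟩ : ∃ i, 2 * x i j ≤ ∑ k, x k j := by
      let a : Fin n := ⟨0, by omega⟩
      let b : Fin n := ⟨1, by omega⟩
      have hab : a ≠ b := by simp [a, b]
      have h1 : x a j + x b j ≤ ∑ k, x k j := by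
        rw [← Finset.sum_pair (f := fun k => x k j) hab]
        exact Finset.sum_le_sum_of_subset_of_nonneg (Finset.subset_univ _) fun k _ _ => hx k j
      rcases le_total (x a j) (x b j) with h | h
      exacts [⟨a, by linarith⟩, ⟨b, by linarith⟩]
    obtain ⟨k, hk⟩ : ∃ k, w i ≤ m * x i k := by
      by_contra! h
      have h1 : ∑ k, m * x i k < ∑ _k : Fin m, w i :=
        Finset.sum_lt_sum_of_nonempty ⟨⟨0, hm⟩, Finset.mem_univ _⟩ fun k _ => h k
      rw [← Finset.mul_sum, hxw] at h1
      simp at h1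
    obtain ⟨h1, h2⟩ := hε i j k
    have hjk : j ≠ k := by
      rintro rfl
      have := hxT i j
      nlinarith
    have hxk : 0 < x i k := by
      have := hw i
      by_contra! h
      nlinarith
    have hmove := hopt i (fun l => x i l + x i k * ((if l = j then 1 else 0) -
      (if l = k then 1 else 0))) (fun l => ?_) ?_
    · simp only [add_sub_cancel_left, mul_sub, mul_ite, mul_one, mul_zero,
        Finset.sum_sub_distrib, Finset.sum_ite_eq', Finset.mem_univ, if_true] at hmove
      rw [← sub_mul] at hmove
      have hle := nonpos_of_mul_nonpos_left hmove hxk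
      have hτj : τ x j = ε := max_eq_right hlt.le
      have hlow : v i j / (2 * ε) ≤ v i j * (τ x j - x i j) / τ x j ^ 2 := by
        rw [hτj, div_le_div_iff₀ (by positivity) (by positivity)]
        have := mul_nonneg (mul_nonneg (hv i j).le hε0.le) (show 0 ≤ ε - 2 * x i j by linarith)
        nlinarith
      have hτk : w i ≤ m * τ x k :=
        hk.trans (mul_le_mul_of_nonneg_left ((hxT i k).trans (le_max_left _ _)) hm0.le)
      have hup : v i k * (τ x k - x i k) / τ x k ^ 2 ≤ v i k * m / w i := by
        rw [div_le_div_iff₀ (pow_pos (hτ x k) 2) (hw i)]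
        have h3 : (τ x k - x i k) * w i ≤ τ x k * (m * τ x k) :=
          mul_le_mul (by linarith) hτk (hw i).le (hτ x k).le
        have := mul_le_mul_of_nonneg_left h3 (hv i k).le
        nlinarith
      rw [← mul_sub, ← mul_sub] at hle
      have hfin : v i j / (2 * ε) ≤ v i k * m / w i := by linarith
      rw [div_le_div_iff₀ (by positivity) (hw i)] at hfin
      linarith
    · split_ifs with hlj hlk hlk
      · exact absurd (hlj.symm.trans hlk) hjk
      · linarith [hx i l]
      · rw [hlk]
        linarith
      · linarith [hx i l]
    · simp [Finset.sum_add_distrib, ← Finset.mul_sum, hxw]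
  have hτT : ∀ j, τ x j = ∑ k, x k j := fun j => max_eq_left (hT j)
  refine ⟨x, hx, hxw, fun i y hy hyw => ?_⟩
  have h := hopt i y hy hyw
  simp only [hτT] at h
  exact util_update_le_of_sum_marginal_nonpos (fun j => (hv i j).le) hx
    (fun j => hε0.trans_le (hT j)) hy h

end Auction

/-- Every Chinese auction with continuous given budgets and strictly
positive (possibly asymmetric) valuations has a pure Nash equilibrium. -/
theorem stmt5 {n m : ℕ} (hm : 0 < m)
    (v : Fin n → Fin m → ℝ) (hv : ∀ i j, 0 < v i j)
    (w : Fin n → ℝ) (hw : ∀ i, 0 < w i) :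
    ∃ x : Fin n → Fin m → ℝ,
      (∀ i j, 0 ≤ x i j) ∧ (∀ i, ∑ j, x i j = w i) ∧
      (∀ i : Fin n, ∀ y : Fin m → ℝ, (∀ j, 0 ≤ y j) → (∑ j, y j = w i) →
        util v (Function.update x i y) i ≤ util v x i) := by
  rcases le_or_gt 2 n with hn | hn
  · exact exists_nash_of_two_le hn hm v hv w hw
  have hsub : Subsingleton (Fin n) := Fin.subsingleton_iff_le_one.2 (by omega)
  have hm0 : (0 : ℝ) < m := Nat.cast_pos.2 hm
  have hsum : ∀ (f : Fin n → ℝ) (i : Fin n), ∑ k, f k = f i := fun f i =>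
    Fintype.sum_subsingleton f i
  refine ⟨fun i _ => w i / m, fun i _ => (div_pos (hw i) hm0).le, fun i => ?_,
    fun i y hy _ => ?_⟩
  · simp only [Finset.sum_const, Finset.card_univ, Fintype.card_fin, nsmul_eq_mul]
    field_simp
  · refine util_update_le_of_sum_marginal_nonpos (fun j => (hv i j).le)
      (fun i _ => (div_pos (hw i) hm0).le) (fun j => ?_) hy ?_
    · rw [hsum _ i]
      exact div_pos (hw i) hm0
    · simp [hsum _ i]
end

section
/- Every pure Nash equilibrium of the Chinese auction with continuous given budgets, strictly positive valuations, arbitrary budgets, and the rule that each unclaimed item is instead given uniformly at random to one of the n players (i.e., σ_{i,j}(x) = x_{i,j}/Σ_k x_{k,j} when Σ_k x_{k,j} > 0 and σ_{i,j}(x) = 1/n when Σ_k x_{k,j} = 0) exists; that is, this modified game has a pure Nash equilibrium. -/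
/-- Utility of player `i` in the random-assignment variant of the Chinese auction:
items receiving no tickets are given uniformly at random to one of the `n` players. -/
noncomputable def utilRand {n m : ℕ} (v : Fin n → Fin m → ℝ) (x : Fin n → Fin m → ℝ)
    (i : Fin n) : ℝ :=
  ∑ j, (if 0 < ∑ k, x k j then x i j / (∑ k, x k j) else 1 / (n : ℝ)) * v i j

/-- A finite set is dominant for a family of rankings if no point ranks strictly above its
minimum in every ranking simultaneously. -/
def IsDominant {I X : Type*} (r : I → X → ℕ) (D : Finset X) : Prop :=
  ∀ y, ∃ i, ∀ x ∈ D, r i y ≤ r i x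

lemma IsDominant.mono {I X : Type*} {r : I → X → ℕ} {D B : Finset X} (hB : IsDominant r B)
    (h : D ⊆ B) : IsDominant r D := fun y =>
  (hB y).imp fun _ hi x hx => hi x (h hx)

open Classical in
/-- The dominant sets with as many elements as there are rankings. -/
noncomputable def primitiveSets {I X : Type*} [Fintype I] [Fintype X] (r : I → X → ℕ) :
    Finset (Finset X) :=
  Finset.univ.filter fun B => B.card = Fintype.card I ∧ IsDominant r B

lemma mem_primitiveSets {I X : Type*} [Fintype I] [Fintype X] {r : I → X → ℕ} {B : Finset X} :
    B ∈ primitiveSets r ↔ B.card = Fintype.card I ∧ IsDominant r B := by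
  simp [primitiveSets]

/-- Adjoining the best point that beats the minima of `D` in all rankings but `e` keeps
dominance, and no other such point does. -/
lemma IsDominant.exists_insert {I X : Type*} [Fintype X] [DecidableEq X]
    {r : I → X → ℕ} (hinj : ∀ i, Function.Injective (r i)) {D : Finset X} (hD : IsDominant r D)
    {μ : I → X} (hμ : ∀ i, μ i ∈ D) (hmin : ∀ i, ∀ x ∈ D, r i (μ i) ≤ r i x)
    {e e' : I} (hne : e' ≠ e) (hee : μ e' = μ e)
    (hY : ∃ y, ∀ i, i ≠ e → r i (μ i) < r i y) :
    ∃ y, y ∉ D ∧ r e y < r e (μ e) ∧ IsDominant r (insert y D) ∧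
      ∀ y', (∀ i, i ≠ e → r i (μ i) < r i y') → IsDominant r (insert y' D) → y' = y := by
  classical
  obtain ⟨y, hy, hymax⟩ := Finset.exists_max_image
    (Finset.univ.filter fun y => ∀ i, i ≠ e → r i (μ i) < r i y) (r e)
    (hY.imp fun y hy => by simpa using hy)
  simp only [Finset.mem_filter, Finset.mem_univ, true_and] at hy hymax
  have hyD : y ∉ D := by
    intro hyD
    obtain ⟨k, hk⟩ := hD y
    by_cases hke : k = e
    · subst hke
      have : y = μ k := hinj k (le_antisymm (hk _ (hμ k)) (hmin k y hyD))
      have h := hy e' hne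
      rw [hee, ← this] at h
      exact lt_irrefl _ h
    · exact absurd (hy k hke) (not_lt.2 (hk _ (hμ k)))
  have hye : r e y < r e (μ e) := by
    obtain ⟨k, hk⟩ := hD y
    by_cases hke : k = e
    · subst hke
      refine lt_of_le_of_ne (hk _ (hμ k)) fun h => hyD ?_
      rw [hinj k h]
      exact hμ k
    · exact absurd (hy k hke) (not_lt.2 (hk _ (hμ k)))
  refine ⟨y, hyD, hye, fun z => ?_, fun y' hy' hdom => ?_⟩
  · by_contra! hz
    have hzY : ∀ i, i ≠ e → r i (μ i) < r i z := by
      intro i hi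
      obtain ⟨x, hx, hxz⟩ := hz i
      rcases Finset.mem_insert.1 hx with rfl | hx
      · exact (hy i hi).trans hxz
      · exact (hmin i x hx).trans_lt hxz
    have hzy := hymax z hzY
    obtain ⟨x, hx, hxz⟩ := hz e
    rcases Finset.mem_insert.1 hx with rfl | hx
    · omega
    · have := hmin e x hx
      omega
  · obtain ⟨i, hi⟩ := hdom y
    by_cases hie : i = e
    · subst hie
      exact hinj i (le_antisymm (hymax y' hy') (hi y' (Finset.mem_insert_self _ _)))
    · exact absurd (hy i hie) (not_lt.2 (hi _ (Finset.mem_insert_of_mem (hμ i))))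

lemma exists_eq_insert_of_subset {X : Type*} [DecidableEq X] {D B : Finset X} {n : ℕ}
    (h : D ⊆ B) (hD : D.card + 1 = n) (hB : B.card = n) : ∃ y, y ∉ D ∧ B = insert y D := by
  obtain ⟨y, hy, hyB⟩ := (Finset.covBy_iff_exists_insert).1
    (Finset.covBy_iff_card_sdiff_eq_one.2 ⟨h, by rw [Finset.card_sdiff_of_subset h]; omega⟩)
  exact ⟨y, hy, hyB.symm⟩

section Slack

variable {I T : Type*} [Fintype I] [Fintype T]
  {r : I → T ⊕ I → ℕ}

open Classical in
/-- A facet containing a proper point lies in an even number of primitive sets. -/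
lemma even_card_primitiveSets_of_inl_mem (hinj : ∀ i, Function.Injective (r i))
    (htop : ∀ i j t, j ≠ i → r i (.inl t) < r i (.inr j))
    {D : Finset (T ⊕ I)} (hcard : D.card + 1 = Fintype.card I) {t : T} (ht : Sum.inl t ∈ D) :
    Even ((primitiveSets r).filter (D ⊆ ·)).card := by
  rcases ((primitiveSets r).filter (D ⊆ ·)).eq_empty_or_nonempty with h0 | ⟨B₀, hB₀⟩
  · simp [h0]
  rw [Finset.mem_filter, mem_primitiveSets] at hB₀
  have hD : IsDominant r D := hB₀.1.2.mono hB₀.2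
  have hex : ∀ i, ∃ x ∈ D, ∀ x' ∈ D, r i x ≤ r i x' := fun i =>
    Finset.exists_min_image D (r i) ⟨_, ht⟩
  choose μ hμ hmin using hex
  have huniq : ∀ i, ∀ x ∈ D, (∀ x' ∈ D, r i x ≤ r i x') → x = μ i := fun i x hx h =>
    hinj i (le_antisymm (h _ (hμ i)) (hmin i x hx))
  obtain ⟨a, b, hμab, hab⟩ : ∃ a b, μ a = μ b ∧ a ≠ b := by
    by_contra! h
    have := Finset.card_le_card_of_injOn μ (s := Finset.univ) (t := D) (fun i _ => hμ i)
      (fun i _ j _ hij => h i j hij)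
    rw [Finset.card_univ] at this
    omega
  have hY : ∀ e, ∃ y, ∀ i, i ≠ e → r i (μ i) < r i y := fun e =>
    ⟨.inr e, fun i hi => (hmin i _ ht).trans_lt (htop i e t hi.symm)⟩
  obtain ⟨ya, hyaD, hya, hdoma, huna⟩ := hD.exists_insert hinj hμ hmin hab.symm hμab.symm (hY a)
  obtain ⟨yb, hybD, hyb, hdomb, hunb⟩ := hD.exists_insert hinj hμ hmin hab hμab (hY b)
  -- in a primitive set `insert y D` the minima of `D` persist in all rankings but one
  have key : ∀ y, y ∉ D → IsDominant r (insert y D) →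
      ∃ e, (e = a ∨ e = b) ∧ ∀ i, i ≠ e → r i (μ i) < r i y := by
    intro y hy hdom
    obtain ⟨e, he⟩ := hdom y
    have hsurj : ∀ z ∈ D, ∃ i, i ≠ e ∧ z = μ i ∧ r i z ≤ r i y := by
      intro z hz
      obtain ⟨i, hi⟩ := hdom z
      refine ⟨i, ?_, huniq i z hz fun x hx => hi x (Finset.mem_insert_of_mem hx),
        hi y (Finset.mem_insert_self _ _)⟩
      rintro rfl
      have : z = y := hinj i (le_antisymm (hi y (Finset.mem_insert_self _ _))
        (he z (Finset.mem_insert_of_mem hz)))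
      exact hy (this ▸ hz)
    have himg : (Finset.univ.erase e).image μ = D := by
      ext z
      simp only [Finset.mem_image, Finset.mem_erase, Finset.mem_univ, and_true]
      constructor
      · rintro ⟨i, -, rfl⟩
        exact hμ i
      · intro hz
        obtain ⟨i, hi, hzi, -⟩ := hsurj z hz
        exact ⟨i, hi, hzi.symm⟩
    have hinjOn : Set.InjOn μ (Finset.univ.erase e : Finset I) := by
      rw [← Finset.card_image_iff, himg, Finset.card_erase_of_mem (Finset.mem_univ _),
        Finset.card_univ]
      omega
    refine ⟨e, ?_, fun i hi => ?_⟩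
    · by_contra! h
      exact hab (hinjOn (by simp [h.1.symm]) (by simp [h.2.symm]) hμab)
    · obtain ⟨i', hi', hzi, hle⟩ := hsurj (μ i) (hμ i)
      obtain rfl : i = i' := hinjOn (by simp [hi]) (by simp [hi']) hzi
      refine lt_of_le_of_ne hle fun h => hy ?_
      rw [← hinj i h]
      exact hμ i
  have hyab : ya ≠ yb := by
    rintro rfl
    obtain ⟨e, rfl | rfl, he⟩ := key ya hyaD hdoma
    · exact lt_asymm (he b hab.symm) hyb
    · exact lt_asymm (he a hab) hya
  have heq : (primitiveSets r).filter (D ⊆ ·) = {insert ya D, insert yb D} := by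
    ext B
    simp only [Finset.mem_filter, mem_primitiveSets, Finset.mem_insert, Finset.mem_singleton]
    constructor
    · rintro ⟨⟨hBc, hB⟩, hDB⟩
      obtain ⟨y, hy, rfl⟩ := exists_eq_insert_of_subset hDB hcard hBc
      obtain ⟨e, rfl | rfl, he⟩ := key y hy hB
      · exact .inl (by rw [huna y he hB])
      · exact .inr (by rw [hunb y he hB])
    · rintro (rfl | rfl)
      · exact ⟨⟨by rw [Finset.card_insert_of_notMem hyaD, hcard], hdoma⟩,
          Finset.subset_insert _ _⟩
      · exact ⟨⟨by rw [Finset.card_insert_of_notMem hybD, hcard], hdomb⟩,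
          Finset.subset_insert _ _⟩
  rw [heq, Finset.card_pair fun h => hyab ?_]
  · exact even_two
  · have := Finset.mem_insert_self ya D
    rw [h, Finset.mem_insert] at this
    exact this.resolve_right hyaD

open Classical in
/-- The facet consisting of all slack points but one lies in exactly one primitive set. -/
lemma card_primitiveSets_slack [Nonempty T] (hinj : ∀ i, Function.Injective (r i))
    (hbot : ∀ i x, r i (.inr i) ≤ r i x)
    (htop : ∀ i j t, j ≠ i → r i (.inl t) < r i (.inr j)) (i₀ : I) :
    ((primitiveSets r).filter ((Finset.univ.erase i₀).image Sum.inr ⊆ ·)).card = 1 := by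
  obtain ⟨s, -, hs⟩ := Finset.exists_max_image (Finset.univ : Finset T)
    (fun t => r i₀ (.inl t)) Finset.univ_nonempty
  have hbot' : ∀ i t, ¬ r i (.inl t) ≤ r i (.inr i) := fun i t h =>
    Sum.inl_ne_inr (hinj i (le_antisymm h (hbot i _)))
  set D : Finset (T ⊕ I) := (Finset.univ.erase i₀).image Sum.inr with hDdef
  have hmem : ∀ i, i ≠ i₀ → Sum.inr i ∈ D := fun i hi =>
    Finset.mem_image_of_mem _ (by simp [hi])
  have hcard : D.card + 1 = Fintype.card I := by
    rw [hDdef, Finset.card_image_of_injective _ Sum.inr_injective,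
      Finset.card_erase_add_one (Finset.mem_univ _), Finset.card_univ]
  have hsD : Sum.inl s ∉ D := by simp [hDdef]
  rw [Finset.card_eq_one]
  refine ⟨insert (.inl s) D, ?_⟩
  ext B
  simp only [Finset.mem_filter, mem_primitiveSets, Finset.mem_singleton]
  constructor
  · rintro ⟨⟨hBc, hB⟩, hDB⟩
    obtain ⟨y, hy, rfl⟩ := exists_eq_insert_of_subset hDB hcard hBc
    rcases y with t | k
    · obtain ⟨i, hi⟩ := hB (.inl s)
      by_cases hii : i = i₀
      · subst hii
        have h1 := hi _ (Finset.mem_insert_self _ _)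
        rw [hinj i (le_antisymm h1 (hs t (Finset.mem_univ _)))]
      · exact absurd (hi _ (Finset.mem_insert_of_mem (hmem i hii))) (hbot' i s)
    · obtain ⟨i, hi⟩ := hB (.inl s)
      refine absurd (hi (.inr i) ?_) (hbot' i s)
      by_cases hii : i = i₀
      · have : k = i₀ := by
          by_contra hk
          exact hy (hmem k hk)
        rw [hii, this]
        exact Finset.mem_insert_self _ _
      · exact Finset.mem_insert_of_mem (hmem i hii)
  · rintro rfl
    refine ⟨⟨by rw [Finset.card_insert_of_notMem hsD, hcard], ?_⟩, Finset.subset_insert _ _⟩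
    rintro (t | k)
    · refine ⟨i₀, fun x hx => ?_⟩
      rcases Finset.mem_insert.1 hx with rfl | hx
      · exact hs t (Finset.mem_univ _)
      · obtain ⟨j, hj, rfl⟩ := Finset.mem_image.1 hx
        exact (htop i₀ j t (Finset.ne_of_mem_erase hj)).le
    · exact ⟨k, fun x _ => hbot k x⟩

open Classical in
/-- **Scarf lemma**: every colouring giving slack point `i` the colour `i` admits a primitive
set carrying all colours. -/
theorem exists_primitiveSet_image_eq_univ [Nonempty T] [Nonempty I]
    (hinj : ∀ i, Function.Injective (r i))
    (hbot : ∀ i x, r i (.inr i) ≤ r i x)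
    (htop : ∀ i j t, j ≠ i → r i (.inl t) < r i (.inr j))
    (c : T ⊕ I → I) (hc : ∀ i, c (.inr i) = i) :
    ∃ B ∈ primitiveSets r, B.image c = Finset.univ := by
  obtain ⟨i₀⟩ := ‹Nonempty I›
  set E : Finset (Finset (T ⊕ I)) := Finset.univ.filter fun D =>
    D.card + 1 = Fintype.card I ∧ D.image c = Finset.univ.erase i₀ with hE
  have hmemE : ∀ D, D ∈ E ↔ D.card + 1 = Fintype.card I ∧ D.image c = Finset.univ.erase i₀ := by
    simp [hE]
  have hcardE : (Finset.univ.erase i₀).card + 1 = Fintype.card I := by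
    rw [Finset.card_erase_add_one (Finset.mem_univ _), Finset.card_univ]
  have hdouble := Finset.sum_card_bipartiteAbove_eq_sum_card_bipartiteBelow
    (s := E) (t := primitiveSets r) (fun D B => D ⊆ B)
  have hodd : Odd (∑ D ∈ E, ((primitiveSets r).filter (D ⊆ ·)).card) := by
    rw [Finset.odd_sum_iff_odd_card_odd]
    have : (E.filter fun D => Odd ((primitiveSets r).filter (D ⊆ ·)).card) =
        {(Finset.univ.erase i₀).image Sum.inr} := by
      ext D
      simp only [Finset.mem_filter, Finset.mem_singleton, hmemE]
      constructor
      · rintro ⟨⟨hDc, hDi⟩, hDo⟩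
        have hno : ∀ t, Sum.inl t ∉ D := fun t ht =>
          Nat.not_even_iff_odd.2 hDo (even_card_primitiveSets_of_inl_mem hinj htop hDc ht)
        ext x
        rcases x with t | i
        · simp [hno t]
        · have hsub : ∀ j, Sum.inr j ∈ D → j ≠ i₀ := fun j hj => by
            have := Finset.mem_image_of_mem c hj
            rw [hDi, hc] at this
            exact Finset.ne_of_mem_erase this
          simp only [Finset.mem_image, Finset.mem_erase, Finset.mem_univ, and_true,
            Sum.inr.injEq, exists_eq_right]
          refine ⟨hsub i, fun hi => ?_⟩
          have : i ∈ D.image c := by rw [hDi]; simp [hi]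
          obtain ⟨x, hx, hxi⟩ := Finset.mem_image.1 this
          rcases x with t | j
          · exact absurd hx (hno t)
          · rw [hc] at hxi
            exact hxi ▸ hx
      · rintro rfl
        refine ⟨⟨?_, ?_⟩, ?_⟩
        · rw [Finset.card_image_of_injective _ Sum.inr_injective, hcardE]
        · rw [Finset.image_image]
          have : c ∘ Sum.inr = id := funext hc
          rw [this, Finset.image_id]
        · rw [card_primitiveSets_slack hinj hbot htop i₀]
          exact odd_one
    rw [this, Finset.card_singleton]
    exact odd_one
  have hodd' : Odd (∑ B ∈ primitiveSets r, (E.filter (· ⊆ B)).card) := by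
    simpa only [Finset.bipartiteAbove, Finset.bipartiteBelow] using hdouble ▸ hodd
  obtain ⟨B, hB, hBo⟩ : ∃ B ∈ primitiveSets r, Odd (E.filter (· ⊆ B)).card := by
    by_contra! h
    exact Nat.not_even_iff_odd.2 hodd'
      (Finset.even_sum _ fun B hB => Nat.not_odd_iff_even.1 (h B hB))
  refine ⟨B, hB, ?_⟩
  obtain ⟨D, hD⟩ := Finset.card_pos.1 hBo.pos
  rw [Finset.mem_filter, hmemE] at hD
  obtain ⟨⟨hDc, hDi⟩, hDB⟩ := hD
  obtain ⟨x, hx, rfl⟩ := exists_eq_insert_of_subset hDB hDc (mem_primitiveSets.1 hB).1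
  by_cases hcx : c x = i₀
  · rw [Finset.image_insert, hDi, hcx, Finset.insert_erase (Finset.mem_univ _)]
  -- otherwise the colour of `x` is repeated exactly once and exactly two facets qualify
  exfalso
  have hcinj : Set.InjOn c D := by
    rw [← Finset.card_image_iff, hDi]
    omega
  obtain ⟨x', hx', hcx'⟩ : ∃ x' ∈ D, c x' = c x := by
    have : c x ∈ D.image c := by rw [hDi]; simp [hcx]
    simpa using this
  have hxx' : x ≠ x' := fun h => hx (h ▸ hx')
  have heq : E.filter (· ⊆ insert x D) = {D, (insert x D).erase x'} := by
    ext D'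
    simp only [Finset.mem_filter, Finset.mem_insert, Finset.mem_singleton, hmemE]
    constructor
    · rintro ⟨⟨hc', hi'⟩, hsub⟩
      obtain ⟨y, hy, hyD⟩ := exists_eq_insert_of_subset hsub hc'
        (mem_primitiveSets.1 hB).1
      have hD'y : D' = (insert x D).erase y := by
        rw [hyD, Finset.erase_insert hy]
      have hyB : y ∈ insert x D := hyD ▸ Finset.mem_insert_self _ _
      by_cases hyx : y = x
      · left
        rw [hD'y, hyx, Finset.erase_insert hx]
      · by_cases hyx' : y = x'
        · right
          rw [hD'y, hyx']
        · exfalso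
          have hinj' : Set.InjOn c D' := by
            rw [← Finset.card_image_iff, hi']
            omega
          refine hxx' (hinj' ?_ ?_ hcx'.symm)
          · simp [hD'y, Ne.symm hyx]
          · simp [hD'y, Ne.symm hyx', hx']
    · rintro (rfl | rfl)
      · exact ⟨⟨hDc, hDi⟩, Finset.subset_insert _ _⟩
      · have hx'B : x' ∈ insert x D := Finset.mem_insert_of_mem hx'
        refine ⟨⟨?_, ?_⟩, Finset.erase_subset _ _⟩
        · rw [Finset.card_erase_add_one hx'B, (mem_primitiveSets.1 hB).1]
        · rw [← hDi]
          ext k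
          simp only [Finset.mem_image, Finset.mem_erase, Finset.mem_insert]
          constructor
          · rintro ⟨z, ⟨hz, rfl | hzD⟩, rfl⟩
            · exact ⟨x', hx', hcx'⟩
            · exact ⟨z, hzD, rfl⟩
          · rintro ⟨z, hz, rfl⟩
            by_cases hzx : z = x'
            · exact ⟨x, ⟨hxx', .inl rfl⟩, by rw [hzx, hcx']⟩
            · exact ⟨z, ⟨hzx, .inr hz⟩, rfl⟩
  have hne : D ≠ (insert x D).erase x' := fun h => by
    have := h ▸ hx'
    simp at this
  rw [heq, Finset.card_pair hne] at hBo
  exact Nat.not_even_iff_odd.2 hBo even_two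

end Slack

/-- A labelling of the grid points of a simplex admits a grid point `p` such that each coordinate
of `p` is small or its label occurs near `p`. -/
theorem exists_grid_point_near_labels {I : Type*} [Fintype I] [Nonempty I] (N : ℕ)
    (c : (I → ℕ) → I) :
    ∃ p : I → ℕ, ∑ i, p i = N ∧ ∀ i, p i ≤ Fintype.card I ∨
      ∃ q : I → ℕ, ∑ i, q i = N ∧ c q = i ∧
        ∀ k, q k ≤ p k + Fintype.card I ∧ p k ≤ q k + Fintype.card I := by
  classical
  set G : Finset (I → ℕ) := Finset.piAntidiag Finset.univ N with hG
  have hmemG : ∀ q, q ∈ G ↔ ∑ i, q i = N := fun q => by simp [hG]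
  have hcomp : ∀ n : ℕ, n ≤ N → ∀ g : I → ℕ, ∑ i, g i = n → ∃ y ∈ G, ∀ i, g i ≤ y i := by
    intro n hn g hg
    obtain ⟨i₁⟩ := ‹Nonempty I›
    refine ⟨g + Pi.single i₁ (N - n), ?_, fun i => by simp⟩
    rw [hmemG]
    simp only [Pi.add_apply, Finset.sum_add_distrib, hg, Finset.sum_pi_single', Finset.mem_univ,
      if_true]
    omega
  have hGne : Nonempty G := by
    obtain ⟨y, hy, -⟩ := hcomp 0 (Nat.zero_le _) 0 (by simp)
    exact ⟨⟨y, hy⟩⟩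
  set M := Fintype.card G
  let e := Fintype.equivFin G
  let e' := Fintype.equivFin I
  let r : I → G ⊕ I → ℕ := fun i => Sum.elim (fun t => 1 + ((t : I → ℕ) i * M + e t))
    (fun j => if j = i then 0 else 1 + ((N + 1) * M + e' j))
  have hleN : ∀ (t : G) i, (t : I → ℕ) i ≤ N := fun t i => by
    rw [← (hmemG _).1 t.2]
    exact Finset.single_le_sum (f := (t : I → ℕ)) (fun _ _ => Nat.zero_le _) (Finset.mem_univ i)
  have hlt : ∀ (t : G) i, (t : I → ℕ) i * M + e t < (N + 1) * M := fun t i => by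
    have h1 := (e t).2
    have h2 := Nat.mul_le_mul_right M (hleN t i)
    rw [Nat.add_mul]
    omega
  have hcoord : ∀ i (y x : G), r i (.inl y) ≤ r i (.inl x) →
      (y : I → ℕ) i ≤ (x : I → ℕ) i := by
    intro i y x h
    by_contra! hxy
    have h1 := (e x).2
    have h2 := Nat.mul_le_mul_right M (Nat.succ_le_of_lt hxy)
    simp only [r, Sum.elim_inl] at h
    rw [Nat.succ_mul] at h2
    omega
  have hbot : ∀ i x, r i (.inr i) ≤ r i x := fun i x => by simp [r]
  have htop : ∀ i j t, j ≠ i → r i (.inl t) < r i (.inr j) := by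
    intro i j t hj
    have := hlt t i
    simp only [r, Sum.elim_inl, Sum.elim_inr, if_neg hj]
    omega
  have hbot' : ∀ i t, r i (.inr i) < r i (.inl t) := fun i t => by simp [r]
  have hinj : ∀ i, Function.Injective (r i) := by
    rintro i (t | j) (t' | j') h
    · have hc := le_antisymm (hcoord i t t' h.le) (hcoord i t' t h.ge)
      simp only [r, Sum.elim_inl, hc] at h
      congr 1
      exact e.injective (Fin.ext (by omega))
    · by_cases hj : j' = i
      · subst hj
        exact absurd h (hbot' j' t).ne'
      · exact absurd h (htop i j' t hj).ne
    · by_cases hj : j = i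
      · subst hj
        exact absurd h (hbot' j t').ne
      · exact absurd h (htop i j t' hj).ne'
    · simp only [r, Sum.elim_inr] at h
      congr 1
      split_ifs at h with h1 h2 h2
      · rw [h1, h2]
      · omega
      · omega
      · exact e'.injective (Fin.ext (by omega))
  obtain ⟨B, hB, hBc⟩ := exists_primitiveSet_image_eq_univ hinj hbot htop
    (Sum.elim (fun t : G => c t) id) (fun _ => rfl)
  have hdom := (mem_primitiveSets.1 hB).2
  have hlabel : ∀ i, Sum.inr i ∉ B → ∃ t : G, Sum.inl t ∈ B ∧ c t = i := by
    intro i hi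
    have : i ∈ B.image (Sum.elim (fun t : G => c t) id) := hBc ▸ Finset.mem_univ i
    obtain ⟨x, hx, hxi⟩ := Finset.mem_image.1 this
    rcases x with t | j
    · exact ⟨t, hx, hxi⟩
    · exact absurd (show j = i from hxi) (fun h => hi (h ▸ hx))
  obtain ⟨p, hp⟩ : ∃ p : G, Sum.inl p ∈ B := by
    obtain ⟨t⟩ := hGne
    obtain ⟨i, hi⟩ := hdom (.inl t)
    obtain ⟨p, hp, -⟩ := hlabel i fun h => absurd (hi _ h) (not_le.2 (hbot' i t))
    exact ⟨p, hp⟩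
  set σ : Finset I := Finset.univ.filter fun i => Sum.inr i ∉ B with hσ
  have hmin : ∀ i, ∃ t : G, Sum.inl t ∈ B ∧ ∀ t' : G, Sum.inl t' ∈ B →
      (t : I → ℕ) i ≤ (t' : I → ℕ) i := fun i => by
    obtain ⟨t, ht, h⟩ := Finset.exists_min_image (Finset.univ.filter fun t : G => Sum.inl t ∈ B)
      (fun t => (t : I → ℕ) i) ⟨p, by simpa using hp⟩
    exact ⟨t, by simpa using ht, fun t' ht' => h t' (by simpa using ht')⟩
  choose a haB ha using hmin
  have hsum : N < ∑ i ∈ σ, ((a i : I → ℕ) i + 1) := by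
    by_contra! hle
    obtain ⟨y, hy, hya⟩ := hcomp _ hle (fun i => if i ∈ σ then (a i : I → ℕ) i + 1 else 0)
      (by rw [Finset.sum_ite_mem, Finset.univ_inter])
    obtain ⟨i, hi⟩ := hdom (.inl ⟨y, hy⟩)
    have hiσ : i ∈ σ := by
      rw [hσ, Finset.mem_filter]
      exact ⟨Finset.mem_univ _, fun h => absurd (hi _ h) (not_le.2 (hbot' i _))⟩
    have h1 : y i ≤ (a i : I → ℕ) i := hcoord i _ _ (hi _ (haB i))
    have h2 := hya i
    rw [if_pos hiσ] at h2
    omega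
  rw [Finset.sum_add_distrib, Finset.sum_const, smul_eq_mul, mul_one] at hsum
  have hσc : σ.card ≤ Fintype.card I := Finset.card_le_univ _
  have hin : ∀ t : G, Sum.inl t ∈ B → ∀ i ∈ σ,
      (t : I → ℕ) i ≤ (a i : I → ℕ) i + Fintype.card I := by
    intro t ht i hi
    have h1 : ∑ k ∈ σ, (t : I → ℕ) k ≤ N := by
      rw [← (hmemG _).1 t.2]
      exact Finset.sum_le_sum_of_subset (Finset.subset_univ _)
    have h2 : ∑ k ∈ σ.erase i, (a k : I → ℕ) k ≤ ∑ k ∈ σ.erase i, (t : I → ℕ) k :=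
      Finset.sum_le_sum fun k _ => ha k t ht
    have h3 := Finset.add_sum_erase σ (fun k => (t : I → ℕ) k) hi
    have h4 := Finset.add_sum_erase σ (fun k => (a k : I → ℕ) k) hi
    omega
  have hout : ∀ t : G, Sum.inl t ∈ B → ∀ i, i ∉ σ → (t : I → ℕ) i ≤ Fintype.card I := by
    intro t ht i hi
    have h1 : ∑ k ∈ insert i σ, (t : I → ℕ) k ≤ N := by
      rw [← (hmemG _).1 t.2]
      exact Finset.sum_le_sum_of_subset (Finset.subset_univ _)
    rw [Finset.sum_insert hi] at h1
    have h2 : ∑ k ∈ σ, (a k : I → ℕ) k ≤ ∑ k ∈ σ, (t : I → ℕ) k :=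
      Finset.sum_le_sum fun k _ => ha k t ht
    omega
  refine ⟨p, (hmemG _).1 p.2, fun i => ?_⟩
  by_cases hi : i ∈ σ
  · right
    obtain ⟨t, ht, hti⟩ := hlabel i (by simpa [hσ] using hi)
    refine ⟨t, (hmemG _).1 t.2, hti, fun k => ?_⟩
    by_cases hk : k ∈ σ
    · have h1 := hin t ht k hk
      have h2 := hin p hp k hk
      have h3 := ha k t ht
      have h4 := ha k p hp
      omega
    · have h1 := hout t ht k hk
      have h2 := hout p hp k hk
      omega
  · exact .inl (hout p hp i hi)

/-- A continuous self-map of the standard simplex is approximately non-decreasing in every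
coordinate near some point. -/
lemma exists_approx_fixed_point {I : Type*} [Fintype I] [Nonempty I]
    {f : (I → ℝ) → I → ℝ} (hmaps : Set.MapsTo f (stdSimplex ℝ I) (stdSimplex ℝ I)) (N : ℕ) :
    ∃ P ∈ stdSimplex ℝ I, ∀ i, ∃ Q ∈ stdSimplex ℝ I,
      (∀ k, |Q k - P k| ≤ Fintype.card I / ((N : ℝ) + 1)) ∧
      Q i ≤ f Q i + Fintype.card I / ((N : ℝ) + 1) := by
  have hN : (0 : ℝ) < N + 1 := by positivity
  let s : (I → ℕ) → I → ℝ := fun q i => q i / ((N : ℝ) + 1)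
  have hs : ∀ q : I → ℕ, ∑ i, q i = N + 1 → s q ∈ stdSimplex ℝ I := by
    intro q hq
    refine ⟨fun i => by positivity, ?_⟩
    rw [← Finset.sum_div, div_eq_one_iff_eq hN.ne']
    exact_mod_cast hq
  have hlabel : ∀ q : I → ℕ, ∃ i, ∑ i, q i = N + 1 → s q i ≤ f (s q) i := by
    intro q
    by_cases hq : ∑ i, q i = N + 1
    · have h1 := (hs q hq).2
      have h2 := (hmaps (hs q hq)).2
      obtain ⟨i, -, hi⟩ := Finset.exists_le_of_sum_le (f := s q) (g := f (s q))
        Finset.univ_nonempty (h1.trans h2.symm).le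
      exact ⟨i, fun _ => hi⟩
    · exact ⟨Classical.arbitrary I, fun h => absurd h hq⟩
  choose c hc using hlabel
  obtain ⟨p, hp, h⟩ := exists_grid_point_near_labels (N + 1) c
  refine ⟨s p, hs p hp, fun i => ?_⟩
  rcases h i with h | ⟨q, hq, hqi, hqp⟩
  · refine ⟨s p, hs p hp, fun k => by simp only [sub_self, abs_zero]; positivity, ?_⟩
    have h1 := (hmaps (hs p hp)).1 i
    have h2 : s p i ≤ Fintype.card I / ((N : ℝ) + 1) := by
      simp only [s]
      gcongr
    linarith
  · refine ⟨s q, hs q hq, fun k => ?_, ?_⟩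
    · simp only [s]
      rw [← sub_div, abs_div, abs_of_pos hN]
      gcongr
      have h1 : (q k : ℝ) ≤ p k + Fintype.card I := by exact_mod_cast (hqp k).1
      have h2 : (p k : ℝ) ≤ q k + Fintype.card I := by exact_mod_cast (hqp k).2
      rw [abs_le]
      constructor <;> linarith
    · have h1 := hc q hq
      rw [hqi] at h1
      have : (0 : ℝ) ≤ Fintype.card I / ((N : ℝ) + 1) := by positivity
      linarith

open Filter Topology in
/-- **Brouwer fixed point theorem** on the standard simplex. -/
theorem exists_fixed_point_stdSimplex {I : Type*} [Fintype I] [Nonempty I]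
    {f : (I → ℝ) → I → ℝ} (hmaps : Set.MapsTo f (stdSimplex ℝ I) (stdSimplex ℝ I))
    (hf : ContinuousOn f (stdSimplex ℝ I)) : ∃ p ∈ stdSimplex ℝ I, f p = p := by
  choose P hP Q hQ hQP hQf using exists_approx_fixed_point hmaps
  obtain ⟨p, hp, φ, hφ, hlim⟩ := (isCompact_stdSimplex ℝ I).tendsto_subseq hP
  have hε : Tendsto (fun N : ℕ => (Fintype.card I : ℝ) / ((φ N : ℝ) + 1)) atTop (𝓝 0) := by
    have h := (tendsto_one_div_add_atTop_nhds_zero_nat (𝕜 := ℝ)).const_mul (Fintype.card I : ℝ)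
    simp only [mul_zero, mul_one_div] at h
    exact h.comp hφ.tendsto_atTop
  have hle : ∀ i, p i ≤ f p i := by
    intro i
    have hQlim : Tendsto (fun N => Q (φ N) i) atTop (𝓝 p) := by
      rw [tendsto_pi_nhds] at hlim ⊢
      intro k
      have hd : Tendsto (fun N => Q (φ N) i k - P (φ N) k) atTop (𝓝 0) :=
        squeeze_zero_norm (fun N => hQP (φ N) i k) hε
      simpa using hd.add (hlim k)
    have hfQ : Tendsto (fun N => f (Q (φ N) i)) atTop (𝓝 (f p)) :=
      (hf p hp).tendsto.comp (tendsto_nhdsWithin_iff.2 ⟨hQlim, .of_forall fun N => hQ _ _⟩)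
    have h2 := (tendsto_pi_nhds.1 hfQ i).add hε
    rw [add_zero] at h2
    exact le_of_tendsto_of_tendsto' (tendsto_pi_nhds.1 hQlim i) h2 fun N => hQf (φ N) i
  refine ⟨p, hp, funext fun i => ?_⟩
  have hsum : ∑ i, p i = ∑ i, f p i := hp.2.trans (hmaps hp).2.symm
  exact ((Finset.sum_eq_sum_iff_of_le fun i _ => hle i).1 hsum i (Finset.mem_univ i)).symm

/-- The amount of item `j` demanded at price `p` by a player with value `v` for it and marginal
utility `l` of money. -/
noncomputable def quadDemand (v l p : ℝ) : ℝ := max 0 (1 - l * p / v)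

lemma quadDemand_anti {v p l l' : ℝ} (hv : 0 < v) (hp : 0 ≤ p) (h : l ≤ l') :
    quadDemand v l' p ≤ quadDemand v l p := by
  unfold quadDemand
  gcongr

lemma quadDemand_lt {v p l l' : ℝ} (hv : 0 < v) (hp : 0 < p) (h : l < l')
    (hpos : 0 < quadDemand v l' p) : quadDemand v l' p < quadDemand v l p := by
  have h1 : quadDemand v l' p = 1 - l' * p / v := by
    unfold quadDemand at hpos ⊢
    exact max_eq_right (by by_contra! h; rw [max_eq_left h.le] at hpos; exact lt_irrefl _ hpos)
  rw [h1]
  refine lt_of_lt_of_le ?_ (le_max_right _ _)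
  gcongr

lemma mul_quadDemand_le {v l p : ℝ} (hv : 0 < v) (hl : 0 < l) :
    p * quadDemand v l p ≤ v / (4 * l) := by
  unfold quadDemand
  rcases le_total (1 - l * p / v) 0 with h | h
  · rw [max_eq_left h, mul_zero]
    positivity
  · rw [max_eq_right h]
    have : v / (4 * l) - p * (1 - l * p / v) = (v - 2 * l * p) ^ 2 / (4 * l * v) := by
      field_simp
      ring
    have h2 : 0 ≤ (v - 2 * l * p) ^ 2 / (4 * l * v) := by positivity
    linarith

lemma continuous_sum_mul_quadDemand {J : Type*} [Fintype J] (v : J → ℝ) :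
    Continuous fun q : ℝ × (J → ℝ) => ∑ j, q.2 j * quadDemand (v j) q.1 (q.2 j) := by
  unfold quadDemand
  fun_prop

open Filter Topology in
/-- The marginal utility of money exhausting a budget depends continuously on the prices. -/
lemma exists_continuousOn_multiplier {J : Type*} [Fintype J] {v : J → ℝ} (hv : ∀ j, 0 < v j)
    {b : ℝ} (hb : 0 < b) (hb1 : b < 1) :
    ∃ L : (J → ℝ) → ℝ, ContinuousOn L (stdSimplex ℝ J) ∧ ∀ p ∈ stdSimplex ℝ J,
      0 < L p ∧ ∑ j, p j * quadDemand (v j) (L p) (p j) = b := by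
  set G : ℝ → (J → ℝ) → ℝ := fun l p => ∑ j, p j * quadDemand (v j) l (p j) with hG
  have hGc : Continuous fun q : ℝ × (J → ℝ) => G q.1 q.2 := continuous_sum_mul_quadDemand v
  have hanti : ∀ p ∈ stdSimplex ℝ J, ∀ l l', l ≤ l' → G l' p ≤ G l p := fun p hp l l' h =>
    Finset.sum_le_sum fun j _ =>
      mul_le_mul_of_nonneg_left (quadDemand_anti (hv j) (hp.1 j) h) (hp.1 j)
  have hstrict : ∀ p ∈ stdSimplex ℝ J, ∀ l l', l < l' → 0 < G l' p → G l' p < G l p := by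
    intro p hp l l' h hpos
    obtain ⟨j, -, hj⟩ := Finset.exists_lt_of_sum_lt (s := Finset.univ) (f := fun _ : J => (0 : ℝ))
      (g := fun j => p j * quadDemand (v j) l' (p j)) (by simpa using hpos)
    have hpj : 0 < p j := lt_of_le_of_ne (hp.1 j) (by rintro h0; simp [← h0] at hj)
    refine Finset.sum_lt_sum (fun j _ => mul_le_mul_of_nonneg_left
      (quadDemand_anti (hv j) (hp.1 j) h.le) (hp.1 j)) ⟨j, Finset.mem_univ _, ?_⟩
    exact mul_lt_mul_of_pos_left
      (quadDemand_lt (hv j) hpj h (pos_of_mul_pos_right hj hpj.le)) hpj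
  have hzero : ∀ p ∈ stdSimplex ℝ J, G 0 p = 1 := fun p hp => by
    simpa [hG, quadDemand] using hp.2
  have hroot : ∀ p ∈ stdSimplex ℝ J, ∃ l, 0 < l ∧ G l p = b := by
    intro p hp
    have hne : Nonempty J := by
      by_contra h
      rw [not_nonempty_iff] at h
      simpa using hp.2
    have hV : 0 < ∑ j, v j := Finset.sum_pos (fun j _ => hv j) Finset.univ_nonempty
    set K := (∑ j, v j) / b with hK
    have hKpos : 0 < K := div_pos hV hb
    have hGK : G K p ≤ b := by
      have h1 : G K p ≤ ∑ j, v j / (4 * K) :=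
        Finset.sum_le_sum fun j _ => mul_quadDemand_le (hv j) hKpos
      rw [← Finset.sum_div] at h1
      have h2 : (∑ j, v j) / (4 * K) = b / 4 := by
        rw [hK]
        field_simp
      linarith
    obtain ⟨l, hl, hGl⟩ := intermediate_value_Icc' hKpos.le
      (f := fun l => G l p) (by fun_prop) ⟨hGK, by simp only [hzero p hp]; exact hb1.le⟩
    refine ⟨l, lt_of_le_of_ne hl.1 ?_, hGl⟩
    rintro rfl
    have := hzero p hp
    simp only at hGl
    linarith
  choose! L hLpos hL using hroot
  refine ⟨L, fun p₀ hp₀ => ?_, fun p hp => ⟨hLpos p hp, hL p hp⟩⟩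
  have hcont : ∀ l, Tendsto (fun p => G l p) (𝓝[stdSimplex ℝ J] p₀) (𝓝 (G l p₀)) := fun l => by
    have : Continuous fun p => G l p := by fun_prop
    exact this.continuousWithinAt
  refine tendsto_order.2 ⟨fun l hl => ?_, fun l hl => ?_⟩
  · have h1 := hstrict p₀ hp₀ l _ hl (by rw [hL p₀ hp₀]; exact hb)
    rw [hL p₀ hp₀] at h1
    filter_upwards [(hcont l).eventually (lt_mem_nhds h1), self_mem_nhdsWithin] with p hp hpS
    by_contra! h
    have := hanti p hpS _ _ h
    rw [hL p hpS] at this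
    linarith
  · have h1 : G l p₀ < b := by
      by_contra! h
      have := hstrict p₀ hp₀ _ l hl (by linarith)
      rw [hL p₀ hp₀] at this
      linarith
    filter_upwards [(hcont l).eventually (gt_mem_nhds h1), self_mem_nhdsWithin] with p hp hpS
    by_contra! h
    have := hanti p hpS _ _ h
    rw [hL p hpS] at this
    linarith

/-- Existence of equilibrium prices in a Fisher market with separable quadratic utilities. -/
theorem exists_market_equilibrium {I J : Type*} [Fintype I] [Nontrivial I] [Fintype J] [Nonempty J]
    {v : I → J → ℝ} (hv : ∀ i j, 0 < v i j) {b : I → ℝ} (hb : ∀ i, 0 < b i)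
    (hsum : ∑ i, b i = 1) :
    ∃ (p : J → ℝ) (l : I → ℝ), (∀ j, 0 < p j) ∧ (∀ i, 0 < l i) ∧
      (∀ j, ∑ i, quadDemand (v i j) (l i) (p j) = 1) ∧
      ∀ i, ∑ j, p j * quadDemand (v i j) (l i) (p j) = b i := by
  have hb1 : ∀ i, b i < 1 := by
    intro i
    obtain ⟨i', hi'⟩ := exists_ne i
    rw [← hsum]
    exact Finset.single_lt_sum hi' (Finset.mem_univ i) (Finset.mem_univ i') (hb i')
      fun k _ _ => (hb k).le
  choose L hLc hL using fun i => exists_continuousOn_multiplier (hv i) (hb i) (hb1 i)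
  set z : (J → ℝ) → J → ℝ := fun p j => ∑ i, quadDemand (v i j) (L i p) (p j) - 1 with hz
  set Z : (J → ℝ) → ℝ := fun p => ∑ j, max 0 (z p j) with hZ
  have hZnn : ∀ p, 0 ≤ Z p := fun p => Finset.sum_nonneg fun j _ => le_max_left _ _
  have hzc : ContinuousOn z (stdSimplex ℝ J) := by
    simp only [hz, quadDemand]
    fun_prop
  have hZc : ContinuousOn Z (stdSimplex ℝ J) := by
    simp only [hZ]
    fun_prop
  obtain ⟨p, hp, hfix⟩ := exists_fixed_point_stdSimplex
    (f := fun p j => (p j + max 0 (z p j)) / (1 + Z p)) (I := J) (by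
      intro p hp
      have hpos : 0 < 1 + Z p := by linarith [hZnn p]
      refine ⟨fun j => div_nonneg (add_nonneg (hp.1 j) (le_max_left _ _)) hpos.le, ?_⟩
      rw [← Finset.sum_div, Finset.sum_add_distrib, hp.2]
      exact div_self hpos.ne') (by
      refine continuousOn_pi.2 fun j => ContinuousOn.div (by fun_prop) (by fun_prop) ?_
      intro p _
      linarith [hZnn p])
  have hfix' : ∀ j, max 0 (z p j) = p j * Z p := by
    intro j
    have h := congrFun hfix j
    have hpos : 0 < 1 + Z p := by linarith [hZnn p]
    rw [div_eq_iff hpos.ne'] at h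
    linarith
  have hwalras : ∑ j, p j * z p j = 0 := by
    have h1 : ∑ j, p j * z p j =
        ∑ i, ∑ j, p j * quadDemand (v i j) (L i p) (p j) - ∑ j, p j := by
      rw [Finset.sum_comm, ← Finset.sum_sub_distrib]
      refine Finset.sum_congr rfl fun j _ => ?_
      rw [hz, ← Finset.mul_sum]
      ring
    rw [h1, Finset.sum_congr rfl fun i _ => (hL i p hp).2, hsum, hp.2, sub_self]
  obtain ⟨j₀, -, hj₀⟩ := Finset.exists_lt_of_sum_lt (s := Finset.univ) (f := fun _ : J => (0 : ℝ))
    (g := p) (by rw [hp.2]; simp)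
  have hZ0 : Z p = 0 := by
    by_contra hne
    have hZpos : 0 < Z p := lt_of_le_of_ne (hZnn p) (Ne.symm hne)
    have hterm : ∀ j, 0 < p j → 0 < p j * z p j := by
      intro j hj
      refine mul_pos hj ?_
      by_contra! h
      have := hfix' j
      rw [max_eq_left h] at this
      exact (mul_pos hj hZpos).ne this
    have : 0 < ∑ j, p j * z p j := by
      refine Finset.sum_pos' (fun j _ => ?_) ⟨j₀, Finset.mem_univ _, hterm j₀ hj₀⟩
      rcases (hp.1 j).eq_or_lt with h | h
      · rw [← h, zero_mul]
      · exact (hterm j h).le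
    linarith
  have hzle : ∀ j, z p j ≤ 0 := fun j => by
    have := hfix' j
    rw [hZ0, mul_zero] at this
    exact this ▸ le_max_right _ _
  have hppos : ∀ j, 0 < p j := by
    intro j
    refine lt_of_le_of_ne (hp.1 j) fun h => ?_
    have h1 := hzle j
    have h2 : (1 : ℝ) < Fintype.card I := by exact_mod_cast Fintype.one_lt_card
    simp only [hz, ← h, quadDemand, mul_zero, zero_div, sub_zero, zero_le_one, max_eq_right,
      Finset.sum_const, Finset.card_univ, nsmul_eq_mul, mul_one] at h1
    linarith
  refine ⟨p, fun i => L i p, hppos, fun i => (hL i p hp).1, fun j => ?_, fun i => (hL i p hp).2⟩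
  have h := (Finset.sum_eq_zero_iff_of_nonpos fun j _ =>
    mul_nonpos_of_nonneg_of_nonpos (hp.1 j) (hzle j)).1 hwalras j (Finset.mem_univ j)
  have := (mul_eq_zero.1 h).resolve_left (hppos j).ne'
  simp only [hz] at this
  linarith

/-- The tangent-line bound for the value of bidding `y` on an item of price `p`. -/
lemma div_mul_le_quadDemand {v l p y : ℝ} (hv : 0 < v) (hl : 0 < l) (hp : 0 < p) (hy : 0 ≤ y) :
    0 < p - p * quadDemand v l p + y ∧
    y / (p - p * quadDemand v l p + y) * v ≤
      quadDemand v l p * v + l * (y - p * quadDemand v l p) := by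
  unfold quadDemand
  rcases le_total (1 - l * p / v) 0 with h | h
  · have hvl : v ≤ l * p := by
      rw [sub_nonpos, one_le_div hv] at h
      exact h
    rw [max_eq_left h]
    simp only [mul_zero, sub_zero, zero_mul, zero_add]
    refine ⟨by positivity, ?_⟩
    rw [div_mul_eq_mul_div, div_le_iff₀ (by positivity)]
    nlinarith [mul_nonneg hl.le (mul_nonneg hy hy), mul_le_mul_of_nonneg_left hvl hy]
  · rw [max_eq_right h]
    have hD : 0 < p - p * (1 - l * p / v) + y := by
      have : p - p * (1 - l * p / v) = l * p ^ 2 / v := by ring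
      rw [this]
      positivity
    refine ⟨hD, ?_⟩
    set s := 1 - l * p / v with hs
    have hvs : v * (1 - s) = l * p := by
      rw [hs]
      field_simp
      ring
    rw [div_mul_eq_mul_div, div_le_iff₀ hD]
    have : (s * v + l * (y - p * s)) * (p - p * s + y) - y * v = l * (y - p * s) ^ 2 := by
      linear_combination (p * s - y) * hvs
    nlinarith [mul_nonneg hl.le (sq_nonneg (y - p * s))]

/-- The Chinese auction with continuous given budgets, strictly positive
valuations, arbitrary positive budgets, and the rule that unclaimed items are given
uniformly at random to one of the `n` players, has a pure Nash equilibrium. -/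
theorem stmt7 {n m : ℕ} (hn : 0 < n) (hm : 0 < m)
    (v : Fin n → Fin m → ℝ) (hv : ∀ i j, 0 < v i j)
    (w : Fin n → ℝ) (hw : ∀ i, 0 < w i) :
    ∃ x : Fin n → Fin m → ℝ,
      (∀ i j, 0 ≤ x i j) ∧ (∀ i, ∑ j, x i j = w i) ∧
      (∀ i : Fin n, ∀ y : Fin m → ℝ, (∀ j, 0 ≤ y j) → (∑ j, y j = w i) →
        utilRand v (Function.update x i y) i ≤ utilRand v x i) := by
  have : Nonempty (Fin m) := ⟨⟨0, hm⟩⟩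
  rcases Nat.lt_or_ge 1 n with hn2 | hn1
  · have : Nontrivial (Fin n) := Fin.nontrivial_iff_two_le.2 hn2
    set W := ∑ i, w i with hW
    have hWpos : 0 < W := Finset.sum_pos (fun i _ => hw i) Finset.univ_nonempty
    obtain ⟨p, l, hp, hl, hclear, hbudget⟩ := exists_market_equilibrium hv
      (fun i => div_pos (hw i) hWpos) (by rw [← Finset.sum_div, div_self hWpos.ne'])
    have hscale : ∀ i j, quadDemand (v i j) (l i / W) (W * p j) =
        quadDemand (v i j) (l i) (p j) := by
      intro i j
      unfold quadDemand
      congr 3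
      field_simp
    set x : Fin n → Fin m → ℝ := fun i j => W * p j * quadDemand (v i j) (l i) (p j) with hx
    have hnn : ∀ i j, 0 ≤ x i j := fun i j =>
      mul_nonneg (mul_pos hWpos (hp j)).le (le_max_left _ _)
    have hxw : ∀ i, ∑ j, x i j = w i := by
      intro i
      simp only [hx, mul_assoc]
      rw [← Finset.mul_sum, hbudget, mul_div_cancel₀ _ hWpos.ne']
    have hcol : ∀ j, ∑ k, x k j = W * p j := by
      intro j
      simp only [hx]
      rw [← Finset.mul_sum, hclear, mul_one]
    refine ⟨x, hnn, hxw, fun i y hy hyw => ?_⟩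
    have hux : utilRand v x i = ∑ j, quadDemand (v i j) (l i) (p j) * v i j := by
      refine Finset.sum_congr rfl fun j _ => ?_
      have hpos := mul_pos hWpos (hp j)
      rw [hcol, if_pos hpos, hx]
      simp only
      rw [mul_div_cancel_left₀ _ hpos.ne']
    have hcol' : ∀ j, ∑ k, Function.update x i y k j = W * p j - x i j + y j := by
      intro j
      rw [← hcol j, ← Finset.add_sum_erase _ _ (Finset.mem_univ i),
        ← Finset.add_sum_erase _ (fun k => x k j) (Finset.mem_univ i),
        Finset.sum_congr rfl fun k hk => by
          rw [Function.update_of_ne (Finset.ne_of_mem_erase hk)]]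
      simp only [Function.update_self]
      ring
    calc utilRand v (Function.update x i y) i
        ≤ ∑ j, (quadDemand (v i j) (l i) (p j) * v i j + l i / W * (y j - x i j)) := by
          refine Finset.sum_le_sum fun j _ => ?_
          obtain ⟨h1, h2⟩ := div_mul_le_quadDemand (hv i j) (div_pos (hl i) hWpos)
            (mul_pos hWpos (hp j)) (hy j)
          rw [hscale] at h1 h2
          rw [hcol', if_pos h1, Function.update_self]
          exact h2
      _ = utilRand v x i := by
          rw [hux, Finset.sum_add_distrib, ← Finset.mul_sum, Finset.sum_sub_distrib, hyw, hxw,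
            sub_self, mul_zero, add_zero]
  · obtain rfl : n = 1 := by omega
    have hm' : (0 : ℝ) < m := by exact_mod_cast hm
    have hpos : ∀ i, 0 < w i / m := fun i => div_pos (hw i) hm'
    refine ⟨fun i _ => w i / m, fun i _ => (hpos i).le, fun i => ?_, fun i y hy _ => ?_⟩
    · simp only [Finset.sum_const, Finset.card_univ, Fintype.card_fin, nsmul_eq_mul]
      field_simp
    · obtain rfl : i = 0 := Subsingleton.elim _ _
      refine Finset.sum_le_sum fun j _ => mul_le_mul_of_nonneg_right ?_ (hv 0 j).le
      simp only [Finset.univ_unique, Fin.default_eq_zero, Finset.sum_singleton,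
        Function.update_self, if_pos (hpos 0), div_self (hpos 0).ne']
      split_ifs
      · exact div_self_le_one _
      · simp
end
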